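/- Let M be an o-minimal structure, A ⊆ M, and let S be an A-definable downward directed family of subsets of M^n. Then S extends to an A-definable n-type over M. -/

import Mathlib

open FirstOrder Set

/-- `M` is an o-minimal `L`-structure: a densely linearly ordered structure without endpoints,
whose order is `∅`-definable, and in which every definable (with parameters) subset of `M`
is a finite union of points and open intervals with endpoints in `M ∪ {±∞}`. -/
def IsOMinimal (L : FirstOrder.Language) (M : Type*) [L.Structure M] [LinearOrder M] : Prop :=
  Nonempty M ∧ DenselyOrdered M ∧ NoMinOrder M ∧ NoMaxOrder M ∧
  Set.Definable (∅ : Set M) L {v : Fin 2 → M | v 0 < v 1} ∧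
  ∀ s : Set M, Set.Definable₁ (Set.univ : Set M) L s →
    ∃ F : Finset (Set M), s = ⋃₀ (F : Set (Set M)) ∧
      ∀ t ∈ F, (∃ a : M, t = {a}) ∨ (∃ a b : M, t = Set.Ioo a b) ∨
        (∃ a : M, t = Set.Ioi a) ∨ (∃ a : M, t = Set.Iio a) ∨ t = Set.univ

/-- The fiber over `u` of a set `D ⊆ M^{m+n}`, i.e. the set `φ(u, M^n)`. -/
def famFiber {M : Type*} {m n : ℕ} (D : Set (Fin m ⊕ Fin n → M)) (u : Fin m → M) :
    Set (Fin n → M) :=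
  {v | Sum.elim u v ∈ D}

/-- An `A`-definable family of subsets of `M^n`: the family of fibers `φ(u, M^n)` for `u`
ranging over an `A`-definable index set `Ω`, where `φ` is `A`-definable. -/
def IsDefFamily (L : FirstOrder.Language) {M : Type*} [L.Structure M] (A : Set M) (n : ℕ)
    (S : Set (Set (Fin n → M))) : Prop :=
  ∃ (m : ℕ) (Ω : Set (Fin m → M)) (D : Set (Fin m ⊕ Fin n → M)),
    Set.Definable A L Ω ∧ Set.Definable A L D ∧ S = famFiber D '' Ω

/-- A family of sets is downward directed: it does not contain `∅` and any two members
contain a common member. -/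
def DirectedFam {α : Type*} (S : Set (Set α)) : Prop :=
  ∅ ∉ S ∧ ∀ X ∈ S, ∀ Y ∈ S, ∃ Z ∈ S, Z ⊆ X ∩ Y

/-- `S` is finer than `F`: every member of `F` contains a member of `S`. -/
def FinerThan {α : Type*} (S F : Set (Set α)) : Prop :=
  ∀ X ∈ F, ∃ Y ∈ S, Y ⊆ X

/-- A (complete) `n`-type over `M`: an ultrafilter on the Boolean algebra of definable
subsets of `M^n`. -/
def IsTypeOn (L : FirstOrder.Language) {M : Type*} [L.Structure M] (n : ℕ)
    (p : Set (Set (Fin n → M))) : Prop :=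
  (∀ X ∈ p, Set.Definable (Set.univ : Set M) L X) ∧
  ∅ ∉ p ∧
  (∀ X ∈ p, ∀ Y ∈ p, X ∩ Y ∈ p) ∧
  (∀ X ∈ p, ∀ Y : Set (Fin n → M), Set.Definable (Set.univ : Set M) L Y → X ⊆ Y → Y ∈ p) ∧
  (∀ X : Set (Fin n → M), Set.Definable (Set.univ : Set M) L X → X ∈ p ∨ Xᶜ ∈ p)

/-- A type `p` is `A`-definable if for every `∅`-definable `D ⊆ M^{m+n}` the set of
parameters `u` with `φ(u, M^n) ∈ p` is `A`-definable. -/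
def IsDefTypeOver (L : FirstOrder.Language) {M : Type*} [L.Structure M] (A : Set M) (n : ℕ)
    (p : Set (Set (Fin n → M))) : Prop :=
  ∀ (m : ℕ) (D : Set (Fin m ⊕ Fin n → M)), Set.Definable (∅ : Set M) L D →
    Set.Definable A L {u : Fin m → M | famFiber D u ∈ p}

/-- A family `F` is complete for a family `X` if each member of `X` either contains a member
of `F` or is disjoint from one. -/
def CompleteFor {α : Type*} (F X : Set (Set α)) : Prop :=
  ∀ Y ∈ X, ∃ Z ∈ F, Z ⊆ Y ∨ Z ∩ Y = ∅

/-- A family of subsets of `M^n` is complete if it decides every definable set. -/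
def IsCompleteFam (L : FirstOrder.Language) {M : Type*} [L.Structure M] (n : ℕ)
    (S : Set (Set (Fin n → M))) : Prop :=
  ∀ X : Set (Fin n → M), Set.Definable (Set.univ : Set M) L X → ∃ Z ∈ S, Z ⊆ X ∨ Z ∩ X = ∅

/-- `B` is a basis for the type `p`: a downward directed subfamily generating `p`. -/
def IsBasisOfType {α : Type*} (B p : Set (Set α)) : Prop :=
  B ⊆ p ∧ DirectedFam B ∧ ∀ Y ∈ p, ∃ Z ∈ B, Z ⊆ Y

/-- `p` has an `A`-definable basis. -/
def HasDefBasis (L : FirstOrder.Language) {M : Type*} [L.Structure M] (A : Set M) (n : ℕ)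
    (p : Set (Set (Fin n → M))) : Prop :=
  ∃ B, IsDefFamily L A n B ∧ IsBasisOfType B p

/-- `S` has a finite tame transversal: it is covered by finitely many subfamilies, each of
which extends to a definable type. -/
def HasFTT (L : FirstOrder.Language) {M : Type*} [L.Structure M] (n : ℕ)
    (S : Set (Set (Fin n → M))) : Prop :=
  ∃ (N : ℕ) (p : Fin N → Set (Set (Fin n → M))),
    (∀ i, IsTypeOn L n (p i) ∧ IsDefTypeOver L (Set.univ : Set M) n (p i)) ∧
    ∀ X ∈ S, ∃ i, X ∈ p i

/-- The `(m,n)`-property: among any `m` members of the family, some `n` have nonempty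
intersection. -/
def HasMNProperty {α : Type*} (S : Set (Set α)) (m n : ℕ) : Prop :=
  ∀ F : Finset (Set α), ↑F ⊆ S → F.card = m →
    ∃ G ⊆ F, G.card = n ∧ (⋂₀ (G : Set (Set α))).Nonempty

universe u

namespace OM

open Filter

section Framework

/-- Types of finite tuples of elements of `M`. -/
class Tup (M : Type u) (X : Type u) where
  ι : Type
  fin : Finite ι
  e : X ≃ (ι → M)

instance tupSelf (M : Type u) : Tup M M where
  ι := Fin 1
  fin := inferInstance
  e := (Equiv.funUnique (Fin 1) M).symm

instance tupProd (M X Y : Type u) [a : Tup M X] [b : Tup M Y] : Tup M (X × Y) where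
  ι := a.ι ⊕ b.ι
  fin := by
    have := a.fin
    have := b.fin
    infer_instance
  e := (Equiv.prodCongr a.e b.e).trans (Equiv.sumArrowEquivProdArrow a.ι b.ι M).symm

instance tupFun (M : Type u) (α : Type) [Finite α] : Tup M (α → M) where
  ι := α
  fin := inferInstance
  e := Equiv.refl _

instance tupUnit (M : Type u) : Tup M PUnit.{u+1} where
  ι := Empty
  fin := inferInstance
  e := ⟨fun _ => Empty.elim, fun _ => PUnit.unit, fun _ => rfl, fun v => by
    funext i
    exact i.elim⟩

/-- Iterated cartesian powers. -/
def Pw (M : Type u) : ℕ → Type u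
  | 0 => PUnit.{u+1}
  | n + 1 => Pw M n × M

instance tupPw (M : Type u) : (n : ℕ) → Tup M (Pw M n)
  | 0 => tupUnit M
  | n + 1 => @tupProd M (Pw M n) M (tupPw M n) (tupSelf M)

variable {L : FirstOrder.Language} {M : Type u} [L.Structure M]
variable {X Y Z W : Type u} [Tup M X] [Tup M Y] [Tup M Z] [Tup M W]

/-- Definable predicates on a tuple type. -/
def Def (L : FirstOrder.Language) {M : Type u} [L.Structure M] (A : Set M) {X : Type u}
    [Tup M X] (P : X → Prop) : Prop :=
  A.Definable L {v : Tup.ι M X → M | P (Tup.e.symm v)}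

variable {A B : Set M}

theorem Def.mono {P : X → Prop} (h : Def L A P) (hAB : A ⊆ B) : Def L B P :=
  Set.Definable.mono h hAB

theorem Def.congr {P Q : X → Prop} (h : Def L A P) (hPQ : ∀ x, Q x ↔ P x) : Def L A Q := by
  have : Q = P := funext fun x => propext (hPQ x)
  rwa [this]

theorem Def.and {P Q : X → Prop} (h : Def L A P) (h' : Def L A Q) :
    Def L A (fun x => P x ∧ Q x) := Set.Definable.inter h h'

theorem Def.or {P Q : X → Prop} (h : Def L A P) (h' : Def L A Q) :
    Def L A (fun x => P x ∨ Q x) := Set.Definable.union h h'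

theorem Def.not {P : X → Prop} (h : Def L A P) : Def L A (fun x => ¬ P x) :=
  Set.Definable.compl h

theorem Def.imp {P Q : X → Prop} (h : Def L A P) (h' : Def L A Q) :
    Def L A (fun x => P x → Q x) := (h.not.or h').congr fun x => by tauto

theorem Def.iff {P Q : X → Prop} (h : Def L A P) (h' : Def L A Q) :
    Def L A (fun x => P x ↔ Q x) := ((h.imp h').and (h'.imp h)).congr fun x => by tauto

theorem Def.cst (p : Prop) : Def L A (fun _ : X => p) := by
  by_cases hp : p
  · have : {v : Tup.ι M X → M | p} = Set.univ := by simp [hp]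
    unfold Def
    rw [this]
    exact Set.definable_univ
  · have : {v : Tup.ι M X → M | p} = ∅ := by simp [hp]
    unfold Def
    rw [this]
    exact Set.definable_empty

theorem Def.ex {P : X → Y → Prop} (h : Def L A (fun z : X × Y => P z.1 z.2)) :
    Def L A (fun x => ∃ y, P x y) := by
  have := Tup.fin (M := M) (X := X)
  have := Tup.fin (M := M) (X := Y)
  have := Tup.fin (M := M) (X := X × Y)
  have h1 := Set.Definable.image_comp (s := {v : Tup.ι M (X × Y) → M | _})
    h (Sum.inl : Tup.ι M X → Tup.ι M X ⊕ Tup.ι M Y)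
  unfold Def
  convert h1 using 1
  ext v
  constructor
  · rintro ⟨y, hy⟩
    refine ⟨Sum.elim v (Tup.e y), ?_, ?_⟩
    · show P (Tup.e.symm _) (Tup.e.symm _)
      simpa using hy
    · funext i
      simp
  · rintro ⟨w, hw, rfl⟩
    exact ⟨_, hw⟩

theorem Def.all {P : X → Y → Prop} (h : Def L A (fun z : X × Y => P z.1 z.2)) :
    Def L A (fun x => ∀ y, P x y) :=
  (Def.ex (P := fun x y => ¬ P x y) h.not).not.congr fun x => by simp

/-- Coordinate maps. -/
def CMap (M : Type u) {X Y : Type u} [Tup M X] [Tup M Y] (f : X → Y) : Prop :=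
  ∃ σ : Tup.ι M Y → Tup.ι M X, ∀ x i, Tup.e (f x) i = (Tup.e x : _ → M) (σ i)

theorem CMap.id : CMap M (fun x : X => x) := ⟨fun i => i, fun _ _ => rfl⟩

theorem CMap.fst {f : Z → X × Y} (h : CMap M f) : CMap M (fun z => (f z).1) := by
  obtain ⟨σ, hσ⟩ := h
  exact ⟨fun i => σ (Sum.inl i), fun x i => by rw [← hσ]; rfl⟩

theorem CMap.snd {f : Z → X × Y} (h : CMap M f) : CMap M (fun z => (f z).2) := by
  obtain ⟨σ, hσ⟩ := h
  exact ⟨fun i => σ (Sum.inr i), fun x i => by rw [← hσ]; rfl⟩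

theorem CMap.pair {f : Z → X} {g : Z → Y} (h : CMap M f) (h' : CMap M g) :
    CMap M (fun z => (f z, g z)) := by
  obtain ⟨σ, hσ⟩ := h
  obtain ⟨τ, hτ⟩ := h'
  refine ⟨fun i => Sum.elim σ τ i, fun x i => ?_⟩
  rcases i with i | i
  · exact hσ x i
  · exact hτ x i

theorem Def.ccomp {P : Y → Prop} (h : Def L A P) {f : X → Y} (hf : CMap M f) :
    Def L A (fun x => P (f x)) := by
  obtain ⟨σ, hσ⟩ := hf
  have h1 := Set.Definable.preimage_comp (L := L) (A := A) σ h
  unfold Def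
  convert h1 using 1
  ext v
  have : Tup.e (f (Tup.e.symm v)) = v ∘ σ := by
    funext i
    rw [hσ]
    simp
  simp only [Set.mem_ofPred_eq, Set.mem_preimage]
  rw [← this]
  simp

theorem Def.eq_coord {f g : Z → X} (hf : CMap M f) (hg : CMap M g) :
    Def L A (fun z => f z = g z) := by
  obtain ⟨σ, hσ⟩ := hf
  obtain ⟨τ, hτ⟩ := hg
  have := Tup.fin (M := M) (X := X)
  cases nonempty_fintype (Tup.ι M X)
  have h1 : A.Definable L (⋂ i ∈ (Finset.univ : Finset (Tup.ι M X)),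
      {v : Tup.ι M Z → M | v (σ i) = v (τ i)}) := by
    apply Set.definable_biInter_finset
    intro i
    refine ⟨(FirstOrder.Language.Term.equal (FirstOrder.Language.Term.var (σ i))
      (FirstOrder.Language.Term.var (τ i))), ?_⟩
    ext v
    simp
  unfold Def
  convert h1 using 1
  ext v
  simp only [Set.mem_ofPred_eq, Finset.mem_univ, Set.iInter_true, Set.mem_iInter]
  rw [← (Tup.e (M := M) (X := X)).apply_eq_iff_eq, funext_iff]
  refine forall_congr' fun i => ?_
  rw [hσ, hτ]
  simp

/-- Definable maps. -/
def DMap (L : FirstOrder.Language) {M : Type u} [L.Structure M] (A : Set M) {X Y : Type u}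
    [Tup M X] [Tup M Y] (f : X → Y) : Prop :=
  Def L A (fun z : X × Y => z.2 = f z.1)

theorem CMap.dmap {f : X → Y} (h : CMap M f) : DMap L A f := by
  have h1 : CMap M (fun z : X × Y => f z.1) := by
    obtain ⟨σ, hσ⟩ := h
    exact ⟨fun i => Sum.inl (σ i), fun x i => by rw [hσ]; rfl⟩
  exact Def.eq_coord CMap.id.snd h1

theorem DMap.mono {f : X → Y} (h : DMap L A f) (hAB : A ⊆ B) : DMap L B f := Def.mono h hAB

theorem Def.comp {P : Y → Prop} (h : Def L A P) {f : X → Y} (hf : DMap L A f) :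
    Def L A (fun x => P (f x)) := by
  have : Def L A (fun x => ∃ y, y = f x ∧ P y) :=
    Def.ex (Def.and hf (h.ccomp (CMap.id.snd)))
  exact this.congr fun x => by simp

theorem DMap.id : DMap L A (fun x : X => x) := CMap.id.dmap

theorem DMap.comp {g : Y → Z} {f : X → Y} (hg : DMap L A g) (hf : DMap L A f) :
    DMap L A (fun x => g (f x)) := by
  have : Def L A (fun w : X × Z => ∃ y, y = f w.1 ∧ w.2 = g y) := by
    apply Def.ex
    apply Def.and
    · exact Def.ccomp hf (f := fun z : (X × Z) × Y => (z.1.1, z.2))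
        (CMap.pair CMap.id.fst.fst CMap.id.snd)
    · exact Def.ccomp hg (f := fun z : (X × Z) × Y => (z.2, z.1.2))
        (CMap.pair CMap.id.snd CMap.id.fst.snd)
  exact this.congr fun x => by simp

theorem DMap.pair {f : Z → X} {g : Z → Y} (h : DMap L A f) (h' : DMap L A g) :
    DMap L A (fun z => (f z, g z)) := by
  have : Def L A (fun w : Z × (X × Y) => w.2.1 = f w.1 ∧ w.2.2 = g w.1) := by
    apply Def.and
    · exact Def.ccomp h (f := fun z : Z × (X × Y) => (z.1, z.2.1))
        (CMap.pair CMap.id.fst CMap.id.snd.fst)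
    · exact Def.ccomp h' (f := fun z : Z × (X × Y) => (z.1, z.2.2))
        (CMap.pair CMap.id.fst CMap.id.snd.snd)
  exact this.congr fun x => by rw [Prod.ext_iff]

theorem DMap.fst {f : Z → X × Y} (h : DMap L A f) : DMap L A (fun z => (f z).1) :=
  DMap.comp (CMap.id.fst.dmap : DMap L A (fun z : X × Y => z.1)) h

theorem DMap.snd {f : Z → X × Y} (h : DMap L A f) : DMap L A (fun z => (f z).2) :=
  DMap.comp (CMap.id.snd.dmap : DMap L A (fun z : X × Y => z.2)) h

theorem DMap.cst (c : X) : DMap L (Set.univ : Set M) (fun _ : Z => c) := by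
  have := Tup.fin (M := M) (X := X)
  cases nonempty_fintype (Tup.ι M X)
  have h1 : (Set.univ : Set M).Definable L (⋂ i ∈ (Finset.univ : Finset (Tup.ι M X)),
      {v : Tup.ι M (Z × X) → M | v (Sum.inr i) = Tup.e c i}) := by
    apply Set.definable_biInter_finset
    intro i
    refine ⟨(FirstOrder.Language.Term.equal (FirstOrder.Language.Term.var (Sum.inr i))
      (FirstOrder.Language.Constants.term (L.con ⟨Tup.e c i, Set.mem_univ _⟩))), ?_⟩
    ext v
    simp
  unfold DMap Def
  convert h1 using 1
  ext v
  simp only [Set.mem_ofPred_eq, Finset.mem_univ, Set.iInter_true, Set.mem_iInter]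
  rw [← (Tup.e (M := M) (X := X)).apply_eq_iff_eq, funext_iff]
  refine forall_congr' fun i => ?_
  have : Tup.e ((Tup.e (M := M) (X := Z × X)).symm v).2 i = v (Sum.inr i) := by
    show Tup.e (Tup.e.symm (fun j => v (Sum.inr j))) i = _
    simp
  rw [this]

theorem DMap.star : DMap L A (fun _ : Z => PUnit.unit.{u+1}) :=
  CMap.dmap ⟨fun i => i.elim, fun _ i => i.elim⟩

theorem Def.eq {f g : Z → X} (hf : DMap L A f) (hg : DMap L A g) :
    Def L A (fun z => f z = g z) :=
  Def.comp (Def.eq_coord (CMap.id.fst : CMap M (fun z : X × X => z.1)) CMap.id.snd) (hf.pair hg)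

/-- Composition closure, one argument. -/
theorem Def.c1 {P : X → Prop} (h : Def L A P) : ∀ (Z : Type u) [Tup M Z] (f : Z → X),
    DMap L A f → Def L A (fun z => P (f z)) := fun _ _ _ hf => h.comp hf

theorem Def.c2 {P : X → Y → Prop} (h : Def L A (fun z : X × Y => P z.1 z.2)) :
    ∀ (Z : Type u) [Tup M Z] (f : Z → X) (g : Z → Y),
    DMap L A f → DMap L A g → Def L A (fun z => P (f z) (g z)) :=
  fun _ _ _ _ hf hg => h.comp (hf.pair hg)

theorem Def.c3 {P : X → Y → W → Prop} (h : Def L A (fun z : X × Y × W => P z.1 z.2.1 z.2.2)) :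
    ∀ (Z : Type u) [Tup M Z] (f : Z → X) (g : Z → Y) (k : Z → W),
    DMap L A f → DMap L A g → DMap L A k → Def L A (fun z => P (f z) (g z) (k z)) :=
  fun _ _ _ _ _ hf hg hk => h.comp (hf.pair (hg.pair hk))

theorem DMap.c1 {F : X → Y} (h : DMap L A F) : ∀ (Z : Type u) [Tup M Z] (f : Z → X),
    DMap L A f → DMap L A (fun z => F (f z)) := fun _ _ _ hf => h.comp hf

end Framework

end OM



set_option linter.unusedSectionVars false

namespace OM

open Filter

/-- O-minimality as a class. -/
class OMin (L : FirstOrder.Language) (M : Type u) [L.Structure M] [LinearOrder M] : Prop where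
  out : IsOMinimal L M

section Order

variable {L : FirstOrder.Language} {M : Type u} [L.Structure M] [LinearOrder M] [OMin L M]
variable {X Y Z W : Type u} [Tup M X] [Tup M Y] [Tup M Z] [Tup M W]
variable {A B : Set M}

theorem Def.lt {f g : Z → M} (hf : DMap L A f) (hg : DMap L A g) :
    Def L A (fun z => f z < g z) := by
  have h0 : Def L A (fun z : M × M => z.1 < z.2) := by
    have h1 := (OMin.out (L := L) (M := M)).2.2.2.2.1
    have h2 := (h1.mono (Set.empty_subset A)).preimage_comp
      (![Sum.inl 0, Sum.inr 0] : Fin 2 → Fin 1 ⊕ Fin 1)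
    exact h2
  exact h0.c2 _ _ _ hf hg

theorem Def.le {f g : Z → M} (hf : DMap L A f) (hg : DMap L A g) :
    Def L A (fun z => f z ≤ g z) :=
  ((Def.lt hg hf).not).congr fun z => by simp

end Order

section Auto

variable {L : FirstOrder.Language} {M : Type u} [L.Structure M]
variable {X : Type u} [Tup M X] {A : Set M}

set_option linter.unusedVariables false in
/-- Automation for definability goals. -/
theorem Def.auto {P : X → Prop} (h : Def L A P := by
    repeat' first
      | with_reducible exact Def.cst _
      | with_reducible exact DMap.id
      | with_reducible exact DMap.cst _
      | with_reducible exact DMap.star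
      | with_reducible refine Def.and ?_ ?_
      | with_reducible refine Def.or ?_ ?_
      | with_reducible refine Def.not ?_
      | with_reducible refine Def.iff ?_ ?_
      | with_reducible refine Def.imp ?_ ?_
      | with_reducible refine Def.ex ?_
      | with_reducible refine Def.all ?_
      | with_reducible refine Def.lt ?_ ?_
      | with_reducible refine Def.le ?_ ?_
      | with_reducible refine Def.eq ?_ ?_
      | with_reducible refine DMap.fst ?_
      | with_reducible refine DMap.snd ?_
      | apply_assumption -exfalso -symm
      | with_reducible refine DMap.pair ?_ ?_) : Def L A P := h

end Auto

section Basic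

variable {M : Type u} [LinearOrder M] [DenselyOrdered M] [NoMinOrder M] [NoMaxOrder M]

theorem nbhd_left (E : Finset M) (x : M) : ∃ a, a < x ∧ ∀ e ∈ E, e < x → e ≤ a := by
  classical
  induction E using Finset.induction_on with
  | empty => obtain ⟨a, ha⟩ := exists_lt x; exact ⟨a, ha, by simp⟩
  | insert e E _ ih =>
    obtain ⟨a, ha, h⟩ := ih
    by_cases he : e < x
    · refine ⟨max a e, max_lt ha he, fun f hf hfx => ?_⟩
      rcases Finset.mem_insert.1 hf with rfl | hf
      · exact le_max_right _ _
      · exact (h f hf hfx).trans (le_max_left _ _)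
    · refine ⟨a, ha, fun f hf hfx => ?_⟩
      rcases Finset.mem_insert.1 hf with rfl | hf
      · exact absurd hfx he
      · exact h f hf hfx

theorem nbhd_right (E : Finset M) (x : M) : ∃ a, x < a ∧ ∀ e ∈ E, x < e → a ≤ e :=
  nbhd_left (M := Mᵒᵈ) E x

theorem nbhd_avoid (E : Finset M) (x c d : M) (hx : x ∉ E) (hc : c < x) (hd : x < d) :
    ∃ a b, c ≤ a ∧ a < x ∧ x < b ∧ b ≤ d ∧ ∀ e ∈ E, ¬ (a < e ∧ e < b) := by
  obtain ⟨a, ha, h⟩ := nbhd_left E x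
  obtain ⟨b, hb, h'⟩ := nbhd_right E x
  refine ⟨max a c, min b d, le_max_right _ _, max_lt ha hc, lt_min hb hd, min_le_right _ _, ?_⟩
  rintro e he ⟨h1, h2⟩
  rcases lt_trichotomy e x with h3 | h3 | h3
  · exact absurd ((le_max_left _ _).trans_lt h1) (not_lt.2 (h e he h3))
  · exact hx (h3 ▸ he)
  · exact absurd (h2.trans_le (min_le_left _ _)) (not_lt.2 (h' e he h3))

/-- `E` controls the changes of `P`. -/
def Ctl (E : Finset M) (P : M → Prop) : Prop :=
  ∀ d d', d ≤ d' → (∀ e ∈ E, ¬ (d ≤ e ∧ e ≤ d')) → (P d ↔ P d')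

theorem initial_pt (E : Finset M) (D : M → Prop) (hD : ∃ d, D d) :
    ∃ d0, D d0 ∧ ∀ e ∈ E, e ≤ d0 → ∀ d, D d → e ≤ d := by
  classical
  induction E using Finset.induction_on with
  | empty => obtain ⟨a, ha⟩ := hD; exact ⟨a, ha, by simp⟩
  | insert e E _ ih =>
    obtain ⟨a, ha, h⟩ := ih
    by_cases he : ∀ d, D d → e ≤ d
    · refine ⟨a, ha, fun f hf hfx => ?_⟩
      rcases Finset.mem_insert.1 hf with rfl | hf
      · exact he
      · exact h f hf hfx
    · push Not at he
      obtain ⟨d, hd, hde⟩ := he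
      refine ⟨min a d, ?_, fun f hf hfx => ?_⟩
      · rcases min_choice a d with h | h <;> rw [h] <;> assumption
      · rcases Finset.mem_insert.1 hf with rfl | hf
        · exact absurd (hfx.trans (min_le_right _ _)) (not_le.2 hde)
        · exact h f hf (hfx.trans (min_le_left _ _))

theorem endUltra (E : Finset M) (D P : M → Prop) (hP : Ctl E P) (hD : ∃ d, D d) :
    ∃ d0, D d0 ∧ ((∀ d, D d → d ≤ d0 → P d) ∨ (∀ d, D d → d ≤ d0 → ¬ P d)) := by
  by_cases hm : ∃ m, D m ∧ ∀ d, D d → m ≤ d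
  · obtain ⟨m, hm, h⟩ := hm
    refine ⟨m, hm, ?_⟩
    by_cases hp : P m
    · exact Or.inl fun d hd hdm => by rwa [le_antisymm hdm (h d hd)]
    · exact Or.inr fun d hd hdm => by rwa [le_antisymm hdm (h d hd)]
  · obtain ⟨d0, hd0, h⟩ := initial_pt E D hD
    refine ⟨d0, hd0, ?_⟩
    have key : ∀ d, D d → d ≤ d0 → (P d ↔ P d0) := by
      intro d hd hdd
      apply hP d d0 hdd
      rintro e he ⟨h1, h2⟩
      exact hm ⟨d, hd, fun d' hd' => h1.trans (h e he h2 d' hd')⟩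
    by_cases hp : P d0
    · exact Or.inl fun d hd hdm => (key d hd hdm).2 hp
    · exact Or.inr fun d hd hdm => fun h => hp ((key d hd hdm).1 h)

theorem Ctl.dual {E : Finset M} {P : M → Prop} (h : Ctl E P) : Ctl (M := Mᵒᵈ) E P :=
  fun d d' hd he => (h d' d hd fun e h1 h2 => he e h1 ⟨h2.2, h2.1⟩).symm

theorem endUltra' (E : Finset M) (D P : M → Prop) (hP : Ctl E P) (hD : ∃ d, D d) :
    ∃ d0, D d0 ∧ ((∀ d, D d → d0 ≤ d → P d) ∨ (∀ d, D d → d0 ≤ d → ¬ P d)) :=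
  endUltra (M := Mᵒᵈ) E D P hP.dual hD

theorem Ctl.glb {E : Finset M} {P : M → Prop} (h : Ctl E P) (hP : ∃ d, P d)
    (l : M) (hl : ∀ d, P d → l ≤ d) :
    ∃ c, (∀ d, P d → c ≤ d) ∧ ∀ c', (∀ d, P d → c' ≤ d) → c' ≤ c := by
  classical
  by_cases hm : ∃ m, P m ∧ ∀ d, P d → m ≤ d
  · obtain ⟨m, hm, h⟩ := hm
    exact ⟨m, h, fun c' h' => h' m hm⟩
  · obtain ⟨d0, hd0, h0⟩ := initial_pt E P hP
    have key : ∀ l, (∀ d, P d → l ≤ d) → ∃ e ∈ E, e ≤ d0 ∧ l ≤ e := by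
      intro l hl
      by_contra hcon
      push Not at hcon
      have := (h l d0 (hl d0 hd0) (fun e he h1 => absurd (hcon e he h1.2) (not_lt.2 h1.1))).2 hd0
      exact hm ⟨l, this, hl⟩
    obtain ⟨e0, he0, he0', _⟩ := key l hl
    have hne : (E.filter (· ≤ d0)).Nonempty := ⟨e0, by simp [he0, he0']⟩
    have hmem := Finset.max'_mem _ hne
    rw [Finset.mem_filter] at hmem
    refine ⟨_, h0 _ hmem.1 hmem.2, fun c' hc' => ?_⟩
    obtain ⟨e, he, he', hce⟩ := key c' hc'
    exact hce.trans (Finset.le_max' _ _ (by simp [he, he']))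

/-- Boundary points. -/
def bd (P : M → Prop) (e : M) : Prop :=
  ∀ a b, a < e → e < b → ∃ z, a < z ∧ z < b ∧ ¬ (P z ↔ P e)

theorem Ctl.bd_mem {E : Finset M} {P : M → Prop} (h : Ctl E P) {x : M} (hx : bd P x) :
    x ∈ E := by
  by_contra hxE
  obtain ⟨c, hc⟩ := exists_lt x
  obtain ⟨d, hd⟩ := exists_gt x
  obtain ⟨a, b, -, h1, h2, -, h3⟩ := nbhd_avoid E x c d hxE hc hd
  obtain ⟨z, hz1, hz2, hz⟩ := hx a b h1 h2
  rcases le_total z x with hzx | hzx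
  · exact hz (h z x hzx fun e he ⟨h4, h5⟩ => h3 e he ⟨hz1.trans_le h4, h5.trans_lt h2⟩)
  · exact hz (h x z hzx fun e he ⟨h4, h5⟩ => h3 e he ⟨h1.trans_le h4, h5.trans_lt hz2⟩).symm

/-- Pure connectedness principle, from existence of infima. -/
theorem conn_of_glb {P : M → Prop} {d d' : M} (hd : d ≤ d')
    (hglb : (∃ x, d ≤ x ∧ x ≤ d' ∧ ¬ (P x ↔ P d)) →
      ∃ c, (∀ x, (d ≤ x ∧ x ≤ d' ∧ ¬ (P x ↔ P d)) → c ≤ x) ∧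
        ∀ c', (∀ x, (d ≤ x ∧ x ≤ d' ∧ ¬ (P x ↔ P d)) → c' ≤ x) → c' ≤ c)
    (hbd : ∀ e, d ≤ e → e ≤ d' → ¬ bd P e) : P d ↔ P d' := by
  by_contra hcon
  obtain ⟨c, hc1, hc2⟩ := hglb ⟨d', hd, le_rfl, fun h => hcon h.symm⟩
  have hdc : d ≤ c := hc2 d fun x hx => hx.1
  have hcd : c ≤ d' := hc1 d' ⟨hd, le_rfl, fun h => hcon h.symm⟩
  have := hbd c hdc hcd
  unfold bd at this
  push Not at this
  obtain ⟨a, b, hac, hcb, hab⟩ := this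
  have hab : ∀ z, a < z → z < b → (P z ↔ P c) := by
    intro z h1 h2
    have := hab z h1 h2
    tauto
  have hPc : P c ↔ P d := by
    rcases hdc.eq_or_lt with rfl | hlt
    · rfl
    · obtain ⟨z, hz1, hz2⟩ := exists_between (max_lt hac hlt)
      have h1 := hab z ((le_max_left _ _).trans_lt hz1) (hz2.trans hcb)
      have h2 : P z ↔ P d := by
        by_contra h3
        exact absurd (hc1 z ⟨((le_max_right _ _).trans_lt hz1).le, (hz2.trans_le hcd).le, h3⟩)
          (not_le.2 hz2)
      exact h1.symm.trans h2
  have : b ≤ c := by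
    apply hc2
    rintro x ⟨h1, h2, h3⟩
    by_contra hxb
    exact h3 ((hab x (hac.trans_le (hc1 x ⟨h1, h2, h3⟩)) (not_le.1 hxb)).trans hPc)
  exact absurd this (not_le.2 hcb)

end Basic

section OMinBasic

variable {L : FirstOrder.Language} {M : Type u} [L.Structure M] [LinearOrder M] [OMin L M]
  [DenselyOrdered M] [NoMinOrder M] [NoMaxOrder M]

theorem exists_ctl {P : M → Prop} (hP : Def L (univ : Set M) P) : ∃ E : Finset M, Ctl E P := by
  classical
  obtain ⟨F, hF, hF'⟩ := (OMin.out (L := L) (M := M)).2.2.2.2.2 {x | P x} hP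
  have key : ∀ t ∈ F, ∃ E : Finset M, Ctl E (fun x => x ∈ t) := by
    intro t ht
    rcases hF' t ht with ⟨a, rfl⟩ | ⟨a, b, rfl⟩ | ⟨a, rfl⟩ | ⟨a, rfl⟩ | rfl
    · refine ⟨{a}, fun d d' hd h => ?_⟩
      have := h a (by simp)
      simp only [Set.mem_singleton_iff]
      grind
    · refine ⟨{a, b}, fun d d' hd h => ?_⟩
      have := h a (by simp)
      have := h b (by simp)
      simp only [Set.mem_Ioo]
      grind
    · refine ⟨{a}, fun d d' hd h => ?_⟩
      have := h a (by simp)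
      simp only [Set.mem_Ioi]
      grind
    · refine ⟨{a}, fun d d' hd h => ?_⟩
      have := h a (by simp)
      simp only [Set.mem_Iio]
      grind
    · exact ⟨∅, fun d d' hd h => by simp⟩
  choose! E hE using key
  refine ⟨F.biUnion E, fun d d' hd h => ?_⟩
  have h1 : ∀ x, P x ↔ ∃ t ∈ F, x ∈ t := by
    intro x
    have : x ∈ {x | P x} ↔ x ∈ ⋃₀ (F : Set (Set M)) := by rw [hF]
    simpa using this
  rw [h1, h1]
  have h2 : ∀ t ∈ F, (d ∈ t ↔ d' ∈ t) := fun t ht =>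
    hE t ht d d' hd fun e he => h e (Finset.mem_biUnion.2 ⟨t, ht, he⟩)
  constructor
  · rintro ⟨t, ht, h3⟩
    exact ⟨t, ht, (h2 t ht).1 h3⟩
  · rintro ⟨t, ht, h3⟩
    exact ⟨t, ht, (h2 t ht).2 h3⟩

/-- Any infinite definable set contains an interval. -/
theorem exists_interval {P : M → Prop} (hP : Def L (univ : Set M) P) (hinf : {x | P x}.Infinite) :
    ∃ a b, a < b ∧ ∀ x, a < x → x < b → P x := by
  obtain ⟨E, hE⟩ := exists_ctl hP
  obtain ⟨x, hx, hxE⟩ := hinf.exists_notMem_finset E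
  obtain ⟨c, hc⟩ := exists_lt x
  obtain ⟨d, hd⟩ := exists_gt x
  obtain ⟨a, b, -, h1, h2, -, h3⟩ := nbhd_avoid E x c d hxE hc hd
  refine ⟨a, b, h1.trans h2, fun z hz1 hz2 => ?_⟩
  rcases le_total z x with hzx | hzx
  · exact (hE z x hzx fun e he ⟨h4, h5⟩ => h3 e he ⟨hz1.trans_le h4, h5.trans_lt h2⟩).2 hx
  · exact (hE x z hzx fun e he ⟨h4, h5⟩ => h3 e he ⟨h1.trans_le h4, h5.trans_lt hz2⟩).1 hx

theorem exists_sub {P : M → Prop} (hP : Def L (univ : Set M) P) {a b : M} (hab : a < b) :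
    ∃ a' b', a ≤ a' ∧ a' < b' ∧ b' ≤ b ∧
      ((∀ x, a' < x → x < b' → P x) ∨ (∀ x, a' < x → x < b' → ¬ P x)) := by
  obtain ⟨E, hE⟩ := exists_ctl hP
  obtain ⟨x, hx, hxE⟩ := (Set.Ioo_infinite hab).exists_notMem_finset E
  obtain ⟨c, d, hac, h1, h2, hdb, h3⟩ := nbhd_avoid E x a b hxE hx.1 hx.2
  refine ⟨c, d, hac, h1.trans h2, hdb, ?_⟩
  have key : ∀ z, c < z → z < d → (P z ↔ P x) := by
    intro z hz1 hz2
    rcases le_total z x with hzx | hzx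
    · exact (hE z x hzx fun e he ⟨h4, h5⟩ => h3 e he ⟨hz1.trans_le h4, h5.trans_lt h2⟩)
    · exact (hE x z hzx fun e he ⟨h4, h5⟩ => h3 e he ⟨h1.trans_le h4, h5.trans_lt hz2⟩).symm
  by_cases hPx : P x
  · exact Or.inl fun z h1 h2 => (key z h1 h2).2 hPx
  · exact Or.inr fun z h1 h2 h => hPx ((key z h1 h2).1 h)

/-- If `P` holds on an infinite part of the interval, it holds on a subinterval. -/
theorem exists_sub_of_infinite {P : M → Prop} (hP : Def L (univ : Set M) P) {a b : M}
    (hinf : {x | (a < x ∧ x < b) ∧ P x}.Infinite) :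
    ∃ a' b', a ≤ a' ∧ a' < b' ∧ b' ≤ b ∧ (∀ x, a' < x → x < b' → P x) := by
  have hP := hP.c1
  obtain ⟨c, d, hcd, h⟩ := exists_interval (L := L) (P := fun x => (a < x ∧ x < b) ∧ P x)
    Def.auto hinf
  refine ⟨c, d, ?_, hcd, ?_, fun x h1 h2 => (h x h1 h2).2⟩
  · by_contra hlt
    obtain ⟨z, hz1, hz2⟩ := exists_between (lt_min (not_le.1 hlt) hcd)
    exact absurd (h z hz1 (hz2.trans_le (min_le_right _ _))).1.1
      (not_lt.2 (hz2.trans_le (min_le_left _ _)).le)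
  · by_contra hlt
    obtain ⟨z, hz1, hz2⟩ := exists_between (max_lt (not_le.1 hlt) hcd)
    exact absurd (h z ((le_max_right _ _).trans_lt hz1) hz2).1.2
      (not_lt.2 ((le_max_left _ _).trans_lt hz1).le)

theorem finite_bd {P : M → Prop} (hP : Def L (univ : Set M) P) : {x | bd P x}.Finite := by
  obtain ⟨E, hE⟩ := exists_ctl hP
  exact E.finite_toSet.subset fun x hx => hE.bd_mem hx

theorem conn {P : M → Prop} (hP : Def L (univ : Set M) P) {d d' : M} (hd : d ≤ d')
    (hbd : ∀ e, d ≤ e → e ≤ d' → ¬ bd P e) : P d ↔ P d' := by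
  apply conn_of_glb hd _ hbd
  intro hne
  have hP := hP.c1
  obtain ⟨E, hE⟩ := exists_ctl (L := L) (P := fun x => d ≤ x ∧ x ≤ d' ∧ ¬ (P x ↔ P d)) Def.auto
  exact hE.glb hne d fun x hx => hx.1

theorem conn' {P : M → Prop} (hP : Def L (univ : Set M) P) {d d' : M} (hd : d ≤ d')
    (h : ¬ (P d ↔ P d')) : ∃ e, d ≤ e ∧ e ≤ d' ∧ bd P e := by
  by_contra hcon
  push Not at hcon
  exact h (conn hP hd hcon)

theorem exists_glb {P : M → Prop} (hP : Def L (univ : Set M) P) (hne : ∃ d, P d)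
    (l : M) (hl : ∀ d, P d → l ≤ d) :
    ∃ c, (∀ d, P d → c ≤ d) ∧ ∀ c', (∀ d, P d → c' ≤ d) → c' ≤ c := by
  obtain ⟨E, hE⟩ := exists_ctl hP
  exact hE.glb hne l hl

theorem Def.bd {X Z : Type u} [Tup M X] [Tup M Z] {A : Set M} {P : X → M → Prop}
    (hP : Def L A (fun z : X × M => P z.1 z.2)) :
    ∀ (Z : Type u) [Tup M Z] (f : Z → X) (g : Z → M), DMap L A f → DMap L A g →
      Def L A (fun z => bd (P (f z)) (g z)) := by
  have hP := hP.c2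
  have : Def L A (fun z : X × M => OM.bd (P z.1) z.2) := by
    unfold OM.bd
    exact Def.auto
  exact this.c2 (P := fun x e => OM.bd (P x) e)

end OMinBasic

end OM



set_option linter.unusedSectionVars false

namespace OM

open Filter

section Uniform

variable {L : FirstOrder.Language} {M : Type u} [L.Structure M] [LinearOrder M] [OMin L M]
  [DenselyOrdered M] [NoMinOrder M] [NoMaxOrder M]

theorem uniform {P : M → M → Prop} (hP : Def L (univ : Set M) (fun z : M × M => P z.1 z.2))
    {a b : M} (hab : a < b)
    (h : ∀ t, a < t → t < b → ∃ γ, t < γ ∧ ∀ t', t < t' → t' < γ → P t t') :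
    ∃ a' b', a ≤ a' ∧ a' < b' ∧ b' ≤ b ∧ ∀ t t', a' < t → t < t' → t' < b' → P t t' := by
  have hP := hP.c2
  obtain ⟨Q, hQ⟩ : ∃ Q : M → M → Prop, Q = fun t γ => ∀ t', t < t' → t' < γ → P t t' := ⟨_, rfl⟩
  have hQd : Def L (univ : Set M) (fun z : M × M => Q z.1 z.2) := by
    subst hQ
    exact Def.auto
  have hQd := hQd.c2
  have hmono : ∀ t γ γ', γ ≤ γ' → Q t γ' → Q t γ := by
    subst hQ
    exact fun t γ γ' h1 h2 t' h3 h4 => h2 t' h3 (h4.trans_le h1)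
  by_cases hinf : ∃ γ, a < γ ∧ γ < b ∧ {t | (a < t ∧ t < γ) ∧ Q t γ}.Infinite
  · obtain ⟨γ, h1, h2, h3⟩ := hinf
    obtain ⟨a', b', h4, h5, h6, h7⟩ := exists_sub_of_infinite (L := L) Def.auto h3
    refine ⟨a', b', h4, h5, h6.trans h2.le, fun t t' h8 h9 h10 => ?_⟩
    have := h7 t h8 (h9.trans h10)
    rw [hQ] at this
    exact this t' h9 (h10.trans_le h6)
  push Not at hinf
  have small : ∀ t c, a < t → t < b → t < c → ∃ γ, t < γ ∧ γ < c ∧ γ < b ∧ Q t γ := by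
    intro t c h1 h2 h3
    obtain ⟨γ, h4, h5⟩ := h t h1 h2
    obtain ⟨δ, h6, h7⟩ := exists_between (lt_min h4 (lt_min h3 h2))
    refine ⟨δ, h6, h7.trans_le ((min_le_right _ _).trans (min_le_left _ _)),
      h7.trans_le ((min_le_right _ _).trans (min_le_right _ _)), ?_⟩
    exact hmono t δ γ (h7.trans_le (min_le_left _ _)).le (by rw [hQ]; exact h5)
  have hB : ∀ t0, a < t0 → t0 < b → ∃ t, a < t ∧ t ≤ t0 ∧
      ∀ t', a < t' → t' < t → ∃ γ, Q t γ ∧ ¬ Q t' γ := by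
    intro t0 h1 h2
    obtain ⟨γ, h3, -, h5, h6⟩ := small t0 b h1 h2 h2
    have hfin : {t | a < t ∧ t ≤ t0 ∧ ∀ γ, Q t0 γ → Q t γ}.Finite := by
      apply Set.Finite.subset (hinf γ (h1.trans h3) h5)
      rintro t ⟨h7, h8, h9⟩
      exact ⟨⟨h7, h8.trans_lt h3⟩, h9 γ h6⟩
    obtain ⟨t, ⟨h7, h8, h9⟩, h10⟩ := Set.exists_min_image _ _root_.id hfin ⟨t0, h1, le_rfl, fun _ h => h⟩
    refine ⟨t, h7, h8, fun t' h11 h12 => ?_⟩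
    by_contra hcon
    push Not at hcon
    exact absurd (h10 t' ⟨h11, (h12.trans_le h8).le, fun γ hγ => hcon γ (h9 γ hγ)⟩) (not_le.2 h12)
  obtain ⟨E, hE⟩ := exists_ctl (L := L)
    (P := fun t => ∀ t', a < t' → t' < t → ∃ γ, Q t γ ∧ ¬ Q t' γ) Def.auto
  obtain ⟨t1, ⟨h1, h2⟩, h3⟩ := endUltra E (fun t => a < t ∧ t < b) _ hE (exists_between hab)
  have h3 : ∀ t, a < t → t ≤ t1 → ∀ t', a < t' → t' < t → ∃ γ, Q t γ ∧ ¬ Q t' γ := by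
    rcases h3 with h3 | h3
    · exact fun t h4 h5 => h3 t ⟨h4, h5.trans_lt h2⟩ h5
    · obtain ⟨t, h4, h5, h6⟩ := hB t1 h1 h2
      exact absurd h6 (h3 t ⟨h4, h5.trans_lt h2⟩ h5)
  obtain ⟨t2, h4, h5⟩ := exists_between h1
  obtain ⟨γ, h6, h7, h8, h9⟩ := small t2 t1 h4 (h5.trans h2) h5
  exfalso
  refine (Set.Ioo_infinite h6).mono ?_ (hinf γ (h4.trans h6) h8)
  rintro t ⟨h10, h11⟩
  refine ⟨⟨h4.trans h10, h11⟩, ?_⟩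
  obtain ⟨γ', h12, h13⟩ := h3 t (h4.trans h10) (h11.trans h7).le t2 h4 h10
  refine hmono t γ γ' ?_ h12
  by_contra hlt
  exact h13 (hmono t2 γ' γ (not_le.1 hlt).le h9)

theorem uniform2 {P : M → M → Prop} (hP : Def L (univ : Set M) (fun z : M × M => P z.1 z.2))
    {a b : M} (hab : a < b) :
    ∃ a' b', a ≤ a' ∧ a' < b' ∧ b' ≤ b ∧ ((∀ t t', a' < t → t < t' → t' < b' → P t t') ∨
      (∀ t t', a' < t → t < t' → t' < b' → ¬ P t t')) := by
  have hP2 := hP.c2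
  obtain ⟨c, d, h1, h2, h3, h4⟩ := exists_sub (L := L)
    (P := fun t => ∃ γ, t < γ ∧ ∀ t', t < t' → t' < γ → P t t') Def.auto hab
  rcases h4 with h4 | h4
  · obtain ⟨a', b', h5, h6, h7, h8⟩ := uniform hP h2 h4
    exact ⟨a', b', h1.trans h5, h6, h7.trans h3, Or.inl h8⟩
  · have h4' : ∀ t, c < t → t < d → ∃ γ, t < γ ∧ ∀ t', t < t' → t' < γ → ¬ P t t' := by
      intro t h5 h6
      obtain ⟨E, hE⟩ := exists_ctl (L := L) (P := fun t' => P t t') Def.auto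
      obtain ⟨γ, h7, h8⟩ := endUltra E (fun t' => t < t') _ hE (exists_gt t)
      refine ⟨γ, h7, ?_⟩
      rcases h8 with h8 | h8
      · exact absurd ⟨γ, h7, fun t' h9 h10 => h8 t' h9 h10.le⟩ (h4 t h5 h6)
      · exact fun t' h9 h10 => h8 t' h9 h10.le
    obtain ⟨a', b', h5, h6, h7, h8⟩ := uniform (L := L) (P := fun t t' => ¬ P t t') Def.auto h2 h4'
    exact ⟨a', b', h1.trans h5, h6, h7.trans h3, Or.inr h8⟩

/-- Finitely many classes. -/
def FinClasses {X : Type u} (E : X → X → Prop) : Prop := ∃ F : Set X, F.Finite ∧ ∀ x, ∃ f ∈ F, E f x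

theorem finClasses_of_map {X : Type u} {α : Type*} {E : X → X → Prop} (g : X → α)
    (hg : (Set.range g).Finite) (h : ∀ x x', g x = g x' → E x x') : FinClasses E := by
  obtain ⟨F, -, hF⟩ := Set.exists_subset_bijOn (Set.univ : Set X) g
  have hFfin : F.Finite := by
    have : (g '' F).Finite := hg.subset (Set.image_subset_range g F)
    exact Set.Finite.of_finite_image this hF.injOn
  refine ⟨F, hFfin, fun x => ?_⟩
  obtain ⟨f, hf, hfx⟩ := hF.surjOn (show g x ∈ g '' univ from ⟨x, trivial, rfl⟩)
  exact ⟨f, hf, h f x hfx⟩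

theorem finClasses_of_cut {E : M → M → Prop} (hrefl : ∀ x, E x x) (hsymm : ∀ x y, E x y → E y x)
    (N : Set M) (hN : N.Finite) (h : ∀ t t', t ≤ t' → (∀ e ∈ N, ¬ (t ≤ e ∧ e ≤ t')) → E t t') :
    FinClasses E := by
  refine finClasses_of_map (fun t => (N ∩ Set.Iio t, N ∩ Set.Iic t)) ?_ ?_
  · apply (hN.finite_subsets.prod hN.finite_subsets).subset
    rintro _ ⟨t, rfl⟩
    exact ⟨Set.inter_subset_left, Set.inter_subset_left⟩
  · have key : ∀ t t', t ≤ t' → (N ∩ Set.Iio t, N ∩ Set.Iic t) = (N ∩ Set.Iio t', N ∩ Set.Iic t') →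
        E t t' := by
      intro t t' htt heq
      rw [Prod.mk.injEq] at heq
      by_cases hne : t = t'
      · rw [hne]
        exact hrefl _
      apply h t t' htt
      rintro e he ⟨h1, h2⟩
      have h3 : e ∈ N ∩ Set.Iic t := by
        rw [heq.2]
        exact ⟨he, h2⟩
      have h4 : e = t := le_antisymm h3.2 h1
      subst h4
      have h5 : e ∈ N ∩ Set.Iio e := by
        rw [heq.1]
        exact ⟨he, lt_of_le_of_ne h2 hne⟩
      exact lt_irrefl _ h5.2
    intro t t' heq
    rcases le_total t t' with h1 | h1
    · exact key t t' h1 heq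
    · exact hsymm _ _ (key t' t h1 heq.symm)

theorem equiv_curve1 {E : M → M → Prop} (hE : Def L (univ : Set M) (fun z : M × M => E z.1 z.2))
    (hrefl : ∀ x, E x x) (hsymm : ∀ x y, E x y → E y x)
    (htrans : ∀ x y z, E x y → E y z → E x z) (hinf : ¬ FinClasses E) :
    ∃ a b, a < b ∧ ∀ t t', a < t → t < t' → t' < b → ¬ E t t' := by
  by_contra hcon
  push Not at hcon
  have hE2 := hE.c2
  have hloc : ∀ a b : M, a < b → ∃ a' b', a ≤ a' ∧ a' < b' ∧ b' ≤ b ∧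
      ∀ t t', a' < t → t < t' → t' < b' → E t t' := by
    intro a b hab
    obtain ⟨a', b', h1, h2, h3, h4 | h4⟩ := uniform2 hE hab
    · exact ⟨a', b', h1, h2, h3, h4⟩
    · obtain ⟨t, t', h5, h6, h7, h8⟩ := hcon a' b' h2
      exact absurd h8 (h4 t t' h5 h6 h7)
  have hN : {t | ¬ ∃ a b, a < t ∧ t < b ∧ ∀ z, a < z → z < b → E t z}.Finite := by
    by_contra hNinf
    obtain ⟨a, b, hab, h⟩ := exists_interval (L := L)
      (P := fun t => ¬ ∃ a b, a < t ∧ t < b ∧ ∀ z, a < z → z < b → E t z) Def.auto hNinf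
    obtain ⟨a', b', h1, h2, h3, h4⟩ := hloc a b hab
    obtain ⟨t, h5, h6⟩ := exists_between h2
    refine h t (h1.trans_lt h5) (h6.trans_le h3) ⟨a', b', h5, h6, fun z h7 h8 => ?_⟩
    rcases lt_trichotomy t z with h | rfl | h
    · exact h4 t z h5 h h8
    · exact hrefl _
    · exact hsymm _ _ (h4 z t h7 h h6)
  apply hinf
  refine finClasses_of_cut hrefl hsymm _ hN fun t t' htt hno => ?_
  have := (conn (L := L) (P := fun z => E t z) Def.auto htt ?_).1 (hrefl t)
  · exact this
  intro e h1 h2 hbd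
  apply hno e _ ⟨h1, h2⟩
  rintro ⟨a, b, h3, h4, h5⟩
  obtain ⟨z, h6, h7, h8⟩ := hbd a b h3 h4
  have h9 := h5 z h6 h7
  exact h8 ⟨fun h => htrans _ _ _ h (hsymm _ _ h9), fun h => htrans _ _ _ h h9⟩

end Uniform

end OM



set_option linter.unusedSectionVars false

namespace OM

open Filter

section Curves

variable {L : FirstOrder.Language} {M : Type u} [L.Structure M] [LinearOrder M] [OMin L M]
  [DenselyOrdered M] [NoMinOrder M] [NoMaxOrder M]
variable {X : Type u} [Tup M X]

theorem exists_fun {R : M → X → Prop} (hR : Def L (univ : Set M) (fun z : M × X => R z.1 z.2))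
    (huniq : ∀ t y y', R t y → R t y' → y = y') (c : X) :
    ∃ γ : M → X, DMap L (univ : Set M) γ ∧ ∀ t, (∃ y, R t y) → R t (γ t) := by
  classical
  have hR := hR.c2
  have key : ∀ t, ∃ y, (R t y ∨ ((¬ ∃ w, R t w) ∧ y = c)) := by
    intro t
    by_cases h : ∃ w, R t w
    · obtain ⟨w, hw⟩ := h
      exact ⟨w, Or.inl hw⟩
    · exact ⟨c, Or.inr ⟨h, rfl⟩⟩
  choose γ hγ using key
  refine ⟨γ, ?_, ?_⟩
  · have : Def L (univ : Set M) (fun z : M × X => R z.1 z.2 ∨ ((¬ ∃ w, R z.1 w) ∧ z.2 = c)) :=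
      Def.auto
    refine this.congr fun z => ?_
    constructor
    · intro h
      rw [h]
      exact hγ z.1
    · intro h
      rcases h with h | ⟨h, h'⟩
      · rcases hγ z.1 with h1 | ⟨h1, h2⟩
        · exact huniq _ _ _ h h1
        · exact absurd ⟨_, h⟩ h1
      · rcases hγ z.1 with h1 | ⟨h1, h2⟩
        · exact absurd ⟨_, h1⟩ h
        · rw [h', h2]
  · intro t h
    rcases hγ t with h1 | ⟨h1, h2⟩
    · exact h1
    · exact absurd h h1

variable (L M X) in
/-- Generic definable choice over intervals. -/
def ChoiceFor : Prop :=
  ∀ R : M → X → Prop, Def L (univ : Set M) (fun z : M × X => R z.1 z.2) →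
    ∀ a b, a < b → (∀ t, a < t → t < b → ∃ x, R t x) →
    ∃ (a' b' : M) (γ : M → X), a ≤ a' ∧ a' < b' ∧ b' ≤ b ∧ DMap L (univ : Set M) γ ∧
      ∀ t, a' < t → t < b' → R t (γ t)

/-- The initial convex piece of a set. -/
def initPart (R : M → Prop) (y : M) : Prop := R y ∧ ∀ y', y' ≤ y → (∃ w, R w ∧ w ≤ y') → R y'

theorem initPart_nonempty {R : M → Prop} (hR : Def L (univ : Set M) R) (hne : ∃ y, R y) :
    ∃ y, initPart R y := by
  obtain ⟨E, hE⟩ := exists_ctl hR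
  obtain ⟨y0, hy0⟩ := hne
  obtain ⟨d, ⟨w, hw, hwd⟩, h⟩ := endUltra E (fun y => ∃ w, R w ∧ w ≤ y) R hE ⟨y0, y0, hy0, le_rfl⟩
  rcases h with h | h
  · exact ⟨d, h d ⟨w, hw, hwd⟩ le_rfl, fun y' h1 h2 => h y' h2 h1⟩
  · exact absurd hw (h w ⟨w, hw, le_rfl⟩ hwd)

theorem initPart_convex {R : M → Prop} {y1 y y2 : M} (h1 : initPart R y1) (h2 : initPart R y2)
    (h3 : y1 ≤ y) (h4 : y ≤ y2) : initPart R y :=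
  ⟨h2.2 y h4 ⟨y1, h1.1, h3⟩, fun y' h5 h6 => h2.2 y' (h5.trans h4) h6⟩

theorem initPart_nomin {R : M → Prop} (hR : ¬ ∃ y, R y ∧ ∀ y', R y' → y ≤ y') {y : M}
    (h : initPart R y) : ∃ w, w < y ∧ initPart R w := by
  push Not at hR
  obtain ⟨w, hw, hwy⟩ := hR y h.1
  exact ⟨w, hwy, hw, fun y' h1 h2 => h.2 y' (h1.trans hwy.le) h2⟩

theorem choice_disjoint {V : M → M → Prop} (hV : Def L (univ : Set M) (fun z : M × M => V z.1 z.2))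
    {c d : M} (hcd : c < d) (hne : ∀ t, c < t → t < d → ∃ y, V t y)
    (hconv : ∀ t, c < t → t < d → ∀ y1 y y2, V t y1 → V t y2 → y1 ≤ y → y ≤ y2 → V t y)
    (hnomin : ∀ t, c < t → t < d → ∀ y, V t y → ∃ w, w < y ∧ V t w)
    (hdis : ∀ t t', c < t → t < t' → t' < d → ∀ y, V t y → ¬ V t' y) : False := by
  have hV2 := hV.c2
  have hdis' : ∀ y t t', c < t → t < d → c < t' → t' < d → V t y → V t' y → t = t' := by
    intro y t t' h1 h2 h3 h4 h5 h6
    rcases lt_trichotomy t t' with h | h | h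
    · exact absurd h6 (hdis t t' h1 h h4 y h5)
    · exact h
    · exact absurd h5 (hdis t' t h3 h h2 y h6)
  obtain ⟨e1, e2, he, h⟩ := equiv_curve1 (L := L)
    (E := fun y y' => ∀ t, c < t → t < d → (V t y ↔ V t y')) Def.auto
    (fun x t _ _ => Iff.rfl) (fun x y h t h1 h2 => (h t h1 h2).symm)
    (fun x y z h h' t h1 h2 => (h t h1 h2).trans (h' t h1 h2)) (by
      rintro ⟨F, hF, h⟩
      apply Set.Ioo_infinite hcd
      have : (⋃ f ∈ F, {t | (c < t ∧ t < d) ∧ V t f}).Finite := by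
        apply hF.biUnion
        intro f _
        apply Set.Subsingleton.finite
        rintro t ⟨⟨h1, h2⟩, h3⟩ t' ⟨⟨h4, h5⟩, h6⟩
        exact hdis' f t t' h1 h2 h4 h5 h3 h6
      apply this.subset
      rintro t ⟨h1, h2⟩
      obtain ⟨y, hy⟩ := hne t h1 h2
      obtain ⟨f, hf, hfy⟩ := h y
      exact Set.mem_biUnion hf ⟨⟨h1, h2⟩, (hfy t h1 h2).2 hy⟩)
  have : ∃ y, e1 < y ∧ y < e2 ∧ ∃ t, c < t ∧ t < d ∧ V t y := by
    obtain ⟨y1, h1, h2⟩ := exists_between he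
    obtain ⟨y2, h3, h4⟩ := exists_between h2
    by_contra hcon
    push Not at hcon
    apply h y1 y2 h1 h3 h4
    intro t h5 h6
    have := hcon y1 h1 h2 t h5 h6
    have := hcon y2 (h1.trans h3) h4 t h5 h6
    tauto
  obtain ⟨y, h1, h2, t, h3, h4, h5⟩ := this
  obtain ⟨w, h6, h7⟩ := hnomin t h3 h4 y h5
  obtain ⟨z, h8, h9⟩ := exists_between (max_lt h6 h1)
  have hz : V t z := hconv t h3 h4 w z y h7 h5 ((le_max_left _ _).trans_lt h8).le h9.le
  apply h z y ((le_max_right _ _).trans_lt h8) h9 h2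
  intro s h10 h11
  constructor
  · intro h12
    rwa [hdis' z s t h10 h11 h3 h4 h12 hz]
  · intro h12
    rwa [hdis' y s t h10 h11 h3 h4 h12 h5]

/-- A definable family of sets, totally ordered by inclusion, is monotone on a subinterval. -/
theorem mono_family {Y : Type u} [Tup M Y] {G : M → Y → Prop}
    (hG : Def L (univ : Set M) (fun z : M × Y => G z.1 z.2)) {c d : M} (hcd : c < d)
    (htot : ∀ t t', (∀ y, G t y → G t' y) ∨ (∀ y, G t' y → G t y)) :
    ∃ c' d', c ≤ c' ∧ c' < d' ∧ d' ≤ d ∧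
      ((∀ t t', c' < t → t < t' → t' < d' → ∀ y, G t y → G t' y) ∨
       (∀ t t', c' < t → t < t' → t' < d' → ∀ y, G t' y → G t y)) := by
  have hG := hG.c2
  obtain ⟨c', d', h1, h2, h3, h4⟩ := uniform2 (L := L)
    (P := fun t t' => ∀ y, G t y → G t' y) Def.auto hcd
  refine ⟨c', d', h1, h2, h3, ?_⟩
  rcases h4 with h4 | h4
  · exact Or.inl h4
  · exact Or.inr fun t t' h5 h6 h7 => (htot t t').resolve_left (h4 t t' h5 h6 h7)

theorem mono_family_mid {Y : Type u} {G : M → Y → Prop} {c d : M}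
    (h : (∀ t t', c < t → t < t' → t' < d → ∀ y, G t y → G t' y) ∨
       (∀ t t', c < t → t < t' → t' < d → ∀ y, G t' y → G t y)) {t0 t t2 : M} (h0 : c < t0)
    (h1 : t0 < t) (h2 : t < t2) (h3 : t2 < d) {y : Y} (hy : G t0 y) (hy' : G t2 y) : G t y := by
  rcases h with h | h
  · exact h t0 t h0 h1 (h2.trans h3) y hy
  · exact h t t2 (h0.trans h1) h2 h3 y hy'

theorem choice_self : ChoiceFor L M M := by
  intro R hR a b hab hne
  have hR2 := hR.c2
  obtain ⟨a1, b1, ha, hab1, hb, h1⟩ := exists_sub (L := L)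
    (P := fun t => ∃ y, R t y ∧ ∀ y', R t y' → y ≤ y') Def.auto hab
  rcases h1 with h1 | h1
  · obtain ⟨γ, hγ, h⟩ := exists_fun (L := L) (R := fun t y => R t y ∧ ∀ y', R t y' → y ≤ y') Def.auto
      (fun t y y' h h' => le_antisymm (h.2 _ h'.1) (h'.2 _ h.1)) a
    exact ⟨a1, b1, γ, ha, hab1, hb, hγ, fun t h2 h3 => (h t (h1 t h2 h3)).1⟩
  have hVd : Def L (univ : Set M) (fun z : M × M => initPart (R z.1) z.2) := by
    unfold initPart
    exact Def.auto
  have hVd2 := hVd.c2 (P := fun t y => initPart (R t) y)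
  have hVne : ∀ t, a1 < t → t < b1 → ∃ y, initPart (R t) y := fun t h2 h3 =>
    initPart_nonempty (L := L) Def.auto (hne t (ha.trans_lt h2) (h3.trans_le hb))
  obtain ⟨a2, b2, ha2, hab2, hb2, h2⟩ := uniform2 (L := L)
    (P := fun t t' => ∃ y, initPart (R t) y ∧ initPart (R t') y) Def.auto hab1
  rcases h2 with h2 | h2
  swap
  · exfalso
    refine choice_disjoint (L := L) (V := fun t y => initPart (R t) y) hVd hab2 ?_ ?_ ?_ ?_
    · exact fun t h3 h4 => hVne t (ha2.trans_lt h3) (h4.trans_le hb2)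
    · exact fun t h3 h4 y1 y y2 => initPart_convex
    · exact fun t h3 h4 y hy => initPart_nomin (h1 t (ha2.trans_lt h3) (h4.trans_le hb2)) hy
    · intro t t' h3 h4 h5 y h6 h7
      exact h2 t t' h3 h4 h5 ⟨y, h6, h7⟩
  · obtain ⟨a3, b3, ha3, hab3, hb3, h3⟩ := mono_family (L := L)
      (G := fun t y => ∃ w, initPart (R t) w ∧ w ≤ y) Def.auto hab2 (by
        intro t t'
        by_contra hcon
        push Not at hcon
        obtain ⟨⟨y, ⟨w, h3, h4⟩, h5⟩, y', ⟨w', h6, h7⟩, h8⟩ := hcon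
        rcases le_total y y' with h | h
        · exact absurd (h4.trans h) (not_le.2 (h8 w h3))
        · exact absurd (h7.trans h) (not_le.2 (h5 w' h6)))
    obtain ⟨a4, b4, ha4, hab4, hb4, h4⟩ := mono_family (L := L)
      (G := fun t y => ∃ w, initPart (R t) w ∧ y ≤ w) Def.auto hab3 (by
        intro t t'
        by_contra hcon
        push Not at hcon
        obtain ⟨⟨y, ⟨w, h3, h4⟩, h5⟩, y', ⟨w', h6, h7⟩, h8⟩ := hcon
        rcases le_total y y' with h | h
        · exact absurd (h.trans h7) (not_le.2 (h5 w' h6))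
        · exact absurd (h.trans h4) (not_le.2 (h8 w h3)))
    obtain ⟨t0, h5, h6⟩ := exists_between hab4
    obtain ⟨t2, h7, h8⟩ := exists_between h6
    obtain ⟨y, hy0, hy2⟩ := h2 t0 t2 (ha3.trans_lt (ha4.trans_lt h5)) h7
      (h8.trans_le (hb4.trans hb3))
    refine ⟨t0, t2, fun _ => y, (ha.trans (ha2.trans (ha3.trans ha4))).trans h5.le, h7,
      h8.le.trans (hb4.trans (hb3.trans (hb2.trans hb))), DMap.cst y, fun t h9 h10 => ?_⟩
    obtain ⟨w, hw, hwy⟩ := mono_family_mid h3 (ha4.trans_lt h5) h9 h10 (h8.trans_le hb4)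
      ⟨y, hy0, le_rfl⟩ ⟨y, hy2, le_rfl⟩
    obtain ⟨w', hw', hwy'⟩ := mono_family_mid h4 h5 h9 h10 h8
      ⟨y, hy0, le_rfl⟩ ⟨y, hy2, le_rfl⟩
    exact (initPart_convex hw hw' hwy hwy').1

theorem choice_step (hX : ChoiceFor L M X) : ChoiceFor L M (X × M) := by
  intro R hR a b hab hne
  have hR2 := hR.c2
  obtain ⟨a1, b1, γ1, ha1, hab1, hb1, hγ1, h1⟩ := choice_self (L := L) (fun t y => ∃ x, R t (x, y))
    Def.auto a b hab (fun t h1 h2 => by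
      obtain ⟨⟨x, y⟩, h⟩ := hne t h1 h2
      exact ⟨y, x, h⟩)
  have hγ1' := hγ1.c1
  obtain ⟨a2, b2, γ2, ha2, hab2, hb2, hγ2, h2⟩ := hX (fun t x => R t (x, γ1 t)) Def.auto a1 b1 hab1 h1
  exact ⟨a2, b2, fun t => (γ2 t, γ1 t), ha1.trans ha2, hab2, hb2.trans hb1, hγ2.pair hγ1, h2⟩

theorem choice_unit : ChoiceFor L M PUnit.{u+1} := by
  intro R hR a b hab hne
  refine ⟨a, b, fun _ => PUnit.unit, le_rfl, hab, le_rfl, DMap.star, fun t h1 h2 => ?_⟩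
  obtain ⟨⟨⟩, h⟩ := hne t h1 h2
  exact h

theorem choice_pw : ∀ n, ChoiceFor L M (Pw M n)
  | 0 => choice_unit
  | n + 1 => choice_step (choice_pw n)

variable (L M X) in
/-- Curves through infinitely many classes. -/
def CurveFor : Prop :=
  ∀ E : X → X → Prop, Def L (univ : Set M) (fun z : X × X => E z.1 z.2) → (∀ x, E x x) →
    (∀ x y, E x y → E y x) → (∀ x y z, E x y → E y z → E x z) → ¬ FinClasses E →
    ∃ (a b : M) (γ : M → X), a < b ∧ DMap L (univ : Set M) γ ∧
      ∀ t t', a < t → t < t' → t' < b → ¬ E (γ t) (γ t')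

theorem curve_unit : CurveFor L M PUnit.{u+1} := by
  intro E _ hrefl _ _ hinf
  exact absurd ⟨{PUnit.unit}, Set.finite_singleton _, fun x => ⟨x, by simp, hrefl x⟩⟩ hinf

theorem curve_step (hC : ChoiceFor L M X) (hX : CurveFor L M X) : CurveFor L M (X × M) := by
  intro E hE hrefl hsymm htrans hinf
  have hE2 := hE.c2
  by_cases hsl : ∃ t, ¬ FinClasses (fun x x' => E (x, t) (x', t))
  · obtain ⟨t, ht⟩ := hsl
    obtain ⟨a, b, γ, hab, hγ, h⟩ := hX (fun x x' => E (x, t) (x', t)) Def.auto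
      (fun x => hrefl _) (fun x y => hsymm _ _) (fun x y z => htrans _ _ _) ht
    exact ⟨a, b, fun s => (γ s, t), hab, hγ.pair (DMap.cst t), h⟩
  push Not at hsl
  choose F hF hF' using hsl
  by_cases hT : FinClasses (fun t t' => (∀ x, ∃ x', E (x, t) (x', t')) ∧
      (∀ x', ∃ x, E (x, t) (x', t')))
  · exfalso
    obtain ⟨F0, hF0, h⟩ := hT
    apply hinf
    refine ⟨⋃ f ∈ F0, (fun x => (x, f)) '' F f, hF0.biUnion fun f _ => (hF f).image _, ?_⟩
    rintro ⟨x, t⟩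
    obtain ⟨f, hf, h1, h2⟩ := h t
    obtain ⟨x', hx'⟩ := h2 x
    obtain ⟨g, hg, hgx⟩ := hF' f x'
    exact ⟨(g, f), Set.mem_biUnion hf ⟨g, hg, rfl⟩, htrans _ _ _ hgx hx'⟩
  obtain ⟨a, b, hab, h⟩ := equiv_curve1 (L := L) (E := fun t t' => (∀ x, ∃ x', E (x, t) (x', t')) ∧
      (∀ x', ∃ x, E (x, t) (x', t'))) Def.auto
    (fun t => ⟨fun x => ⟨x, hrefl _⟩, fun x => ⟨x, hrefl _⟩⟩)
    (fun t t' h => ⟨fun x => (h.2 x).imp fun _ => hsymm _ _, fun x => (h.1 x).imp fun _ => hsymm _ _⟩)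
    (fun t t' t'' h h' => ⟨fun x => by
        obtain ⟨x', hx'⟩ := h.1 x
        obtain ⟨x'', hx''⟩ := h'.1 x'
        exact ⟨x'', htrans _ _ _ hx' hx''⟩, fun x => by
        obtain ⟨x', hx'⟩ := h'.2 x
        obtain ⟨x'', hx''⟩ := h.2 x'
        exact ⟨x'', htrans _ _ _ hx'' hx'⟩⟩) hT
  obtain ⟨c, d, hac, hcd, hdb, h1⟩ := uniform2 (L := L)
    (P := fun t t' => ∀ x, ∃ x', E (x, t) (x', t')) Def.auto hab
  rcases h1 with h1 | h1
  · exfalso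
    obtain ⟨t0, h2, h3⟩ := exists_between hcd
    obtain ⟨t, ht, t', ht', hne, heq⟩ := (Set.Ioo_infinite h2).exists_ne_map_eq_of_mapsTo
      (f := fun t => {f | f ∈ F t0 ∧ ∃ x, E (x, t) (f, t0)}) (t := {s | s ⊆ F t0})
      (fun t _ f hf => hf.1) (hF t0).finite_subsets
    have key : ∀ t t', t ∈ Set.Ioo c t0 →
        {f | f ∈ F t0 ∧ ∃ x, E (x, t) (f, t0)} = {f | f ∈ F t0 ∧ ∃ x, E (x, t') (f, t0)} →
        ∀ x, ∃ x', E (x, t) (x', t') := by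
      intro t t' ht heq x
      obtain ⟨x0, hx0⟩ := h1 t t0 ht.1 ht.2 h3 x
      obtain ⟨f, hf, hfx⟩ := hF' t0 x0
      have h4 : E (x, t) (f, t0) := htrans _ _ _ hx0 (hsymm _ _ hfx)
      have h5 : f ∈ {f | f ∈ F t0 ∧ ∃ x, E (x, t) (f, t0)} := ⟨hf, x, h4⟩
      rw [heq] at h5
      obtain ⟨_, x', hx'⟩ := h5
      exact ⟨x', htrans _ _ _ h4 (hsymm _ _ hx')⟩
    have k1 := key t t' ht heq
    have k2 := key t' t ht' heq.symm
    have hT1 : ∀ x', ∃ x, E (x, t) (x', t') := fun x => (k2 x).imp fun _ => hsymm _ _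
    have hT2 : ∀ x', ∃ x, E (x, t') (x', t) := fun x => (k1 x).imp fun _ => hsymm _ _
    rcases lt_or_gt_of_ne hne with hlt | hlt
    · exact h t t' (hac.trans_lt ht.1) hlt ((ht'.2.trans h3).trans_le hdb) ⟨k1, hT1⟩
    · exact h t' t (hac.trans_lt ht'.1) hlt ((ht.2.trans h3).trans_le hdb) ⟨k2, hT2⟩
  · obtain ⟨a1, b1, γ, ha1, hab1, hb1, hγ, h2⟩ := hC
      (fun t x => ∃ γ, t < γ ∧ ∀ t', t < t' → t' < γ → ¬ ∃ x', E (x, t) (x', t')) Def.auto c d hcd (by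
        intro t h2 h3
        by_contra hcon
        push Not at hcon
        have hx : ∀ x, ∃ γ, t < γ ∧ ∀ t', t < t' → t' < γ → ∃ x', E (x, t) (x', t') := by
          intro x
          obtain ⟨D, hD⟩ := exists_ctl (L := L) (P := fun t' => ∃ x', E (x, t) (x', t')) Def.auto
          obtain ⟨γ, h4, h5⟩ := endUltra D (fun t' => t < t') _ hD (exists_gt t)
          rcases h5 with h5 | h5
          · exact ⟨γ, h4, fun t' h6 h7 => h5 t' h6 h7.le⟩
          · obtain ⟨t', h6, h7, x', h8⟩ := hcon x γ h4
            exact absurd ⟨x', h8⟩ (h5 t' h6 h7.le)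
        choose g hg hg' using hx
        obtain ⟨e, he, he'⟩ := nbhd_right (((hF t).image g).toFinset) t
        obtain ⟨t', h4, h5⟩ := exists_between (lt_min he h3)
        apply h1 t t' h2 h4 (h5.trans_le (min_le_right _ _))
        intro x
        obtain ⟨f, hf, hfx⟩ := hF' t x
        obtain ⟨x', hx'⟩ := hg' f t' h4 ((h5.trans_le (min_le_left _ _)).trans_le
          (he' (g f) (by simpa using ⟨f, hf, rfl⟩) (hg f)))
        exact ⟨x', htrans _ _ _ (hsymm _ _ hfx) hx'⟩)
    have hγ' := hγ.c1
    obtain ⟨a2, b2, ha2, hab2, hb2, h3⟩ := uniform (L := L)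
      (P := fun t t' => ¬ E (γ t, t) (γ t', t')) Def.auto hab1 (fun t h3 h4 => by
        obtain ⟨e, h5, h6⟩ := h2 t h3 h4
        exact ⟨e, h5, fun t' h7 h8 h9 => h6 t' h7 h8 ⟨_, h9⟩⟩)
    exact ⟨a2, b2, fun t => (γ t, t), hab2, hγ.pair DMap.id, h3⟩

theorem curve_pw : ∀ n, CurveFor L M (Pw M n)
  | 0 => curve_unit
  | n + 1 => curve_step (choice_pw n) (curve_pw n)

end Curves

end OM



set_option linter.unusedSectionVars false

namespace OM

open Filter

section Ends

variable {M : Type u} [LinearOrder M]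

/-- The filter of initial segments of `D`. -/
def lowEnd (D : M → Prop) : Filter M where
  sets := {Y | (∃ d, D d) → ∃ d, D d ∧ ∀ y, D y → y ≤ d → y ∈ Y}
  univ_sets := fun ⟨d, hd⟩ => ⟨d, hd, fun _ _ _ => trivial⟩
  sets_of_superset := fun {s t} hs hst hd => by
    obtain ⟨d, h1, h2⟩ := hs hd
    exact ⟨d, h1, fun y h3 h4 => hst (h2 y h3 h4)⟩
  inter_sets := fun {s t} hs ht hd => by
    obtain ⟨d, h1, h2⟩ := hs hd
    obtain ⟨e, h3, h4⟩ := ht hd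
    refine ⟨min d e, ?_, fun y h5 h6 => ⟨h2 y h5 (h6.trans (min_le_left _ _)),
      h4 y h5 (h6.trans (min_le_right _ _))⟩⟩
    rcases min_choice d e with h | h <;> rw [h] <;> assumption

/-- The filter of final segments of `D`. -/
def highEnd (D : M → Prop) : Filter M where
  sets := {Y | (∃ d, D d) → ∃ d, D d ∧ ∀ y, D y → d ≤ y → y ∈ Y}
  univ_sets := fun ⟨d, hd⟩ => ⟨d, hd, fun _ _ _ => trivial⟩
  sets_of_superset := fun {s t} hs hst hd => by
    obtain ⟨d, h1, h2⟩ := hs hd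
    exact ⟨d, h1, fun y h3 h4 => hst (h2 y h3 h4)⟩
  inter_sets := fun {s t} hs ht hd => by
    obtain ⟨d, h1, h2⟩ := hs hd
    obtain ⟨e, h3, h4⟩ := ht hd
    refine ⟨max d e, ?_, fun y h5 h6 => ⟨h2 y h5 ((le_max_left _ _).trans h6),
      h4 y h5 ((le_max_right _ _).trans h6)⟩⟩
    rcases max_choice d e with h | h <;> rw [h] <;> assumption

theorem eventually_lowEnd {D P : M → Prop} :
    (∀ᶠ y in lowEnd D, P y) ↔ ((∃ d, D d) → ∃ d, D d ∧ ∀ y, D y → y ≤ d → P y) := Iff.rfl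

theorem eventually_highEnd {D P : M → Prop} :
    (∀ᶠ y in highEnd D, P y) ↔ ((∃ d, D d) → ∃ d, D d ∧ ∀ y, D y → d ≤ y → P y) := Iff.rfl

end Ends

section GoodFilters

/-- Good filters: definable-ultra filters with a tameness property. -/
structure Good (L : FirstOrder.Language) (M : Type u) [L.Structure M] [LinearOrder M]
    {X : Type u} [Tup M X] (p : Filter X) : Prop where
  neBot : p.NeBot
  ultra : ∀ P : X → Prop, Def L (univ : Set M) P → (∀ᶠ x in p, P x) ∨ (∀ᶠ x in p, ¬ P x)
  tame : ∀ W : X → M → Prop, Def L (univ : Set M) (fun z : X × M => W z.1 z.2) →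
    (∀ x, {y | W x y}.Finite) → ∀ a b, a < b → ∃ v1 v2, a ≤ v1 ∧ v1 < v2 ∧ v2 ≤ b ∧
      ¬ ∀ᶠ x in p, ∃ y, v1 < y ∧ y < v2 ∧ W x y

/-- Definability of a filter over `A`. -/
def DF (L : FirstOrder.Language) {M : Type u} [L.Structure M] (A : Set M) {X : Type u} [Tup M X]
    (p : Filter X) : Prop :=
  ∀ B, A ⊆ B → ∀ (Z : Type u) [Tup M Z] (P : Z → X → Prop),
    Def L B (fun w : Z × X => P w.1 w.2) → Def L B (fun z => ∀ᶠ x in p, P z x)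

/-- Definability of a family of filters. -/
def UFam (L : FirstOrder.Language) (M : Type u) [L.Structure M] {U X : Type u} [Tup M U] [Tup M X]
    (q : U → Filter X) : Prop :=
  ∀ (Z : Type u) [Tup M Z] (P : Z → X → Prop), Def L (univ : Set M) (fun w : Z × X => P w.1 w.2) →
    Def L (univ : Set M) (fun w : Z × U => ∀ᶠ x in q w.2, P w.1 x)

variable {L : FirstOrder.Language} {M : Type u} [L.Structure M] [LinearOrder M] [OMin L M]
  [DenselyOrdered M] [NoMinOrder M] [NoMaxOrder M]
variable {X Y U : Type u} [Tup M X] [Tup M Y] [Tup M U]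

theorem DF.use {A B : Set M} {p : Filter X} (h : DF L A p) (hAB : A ⊆ B) :
    ∀ (Z : Type u) [Tup M Z] (P : Z → X → Prop),
    Def L B (fun w : Z × X => P w.1 w.2) → Def L B (fun z => ∀ᶠ x in p, P z x) := h B hAB

theorem UFam.use {q : U → Filter X} (h : UFam L M q) :
    ∀ (Z : Type u) [Tup M Z] (f : Z → U) (P : Z → X → Prop), DMap L (univ : Set M) f →
    Def L (univ : Set M) (fun w : Z × X => P w.1 w.2) →
    Def L (univ : Set M) (fun z => ∀ᶠ x in q (f z), P z x) := by
  intro Z _ f P hf hP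
  exact (h Z P hP).comp (f := fun z => (z, f z)) (DMap.id.pair hf)

theorem Good.pure (x : X) : Good L M (pure x : Filter X) where
  neBot := inferInstance
  ultra := fun P _ => by
    simp only [eventually_pure]
    exact em _
  tame := fun W hW hfin a b hab => by
    have hW := hW.c2
    obtain ⟨a', b', h1, h2, h3, h4⟩ := exists_sub (L := L) (P := fun y => W x y) Def.auto hab
    refine ⟨a', b', h1, h2, h3, ?_⟩
    rw [eventually_pure]
    rintro ⟨y, h5, h6, h7⟩
    rcases h4 with h4 | h4
    · exact Set.Ioo_infinite h2 ((hfin x).subset fun z hz => h4 z hz.1 hz.2)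
    · exact h4 y h5 h6 h7

theorem Good.map {p : Filter X} (hp : Good L M p) {f : X → Y} (hf : DMap L (univ : Set M) f) :
    Good L M (Filter.map f p) where
  neBot := by
    have := hp.neBot
    infer_instance
  ultra := fun P hP => by
    simp only [eventually_map]
    exact hp.ultra _ (hP.comp hf)
  tame := fun W hW hfin a b hab => by
    simp only [eventually_map]
    have hW := hW.c2
    have hf := hf.c1
    exact hp.tame (fun x y => W (f x) y) Def.auto (fun x => hfin (f x)) a b hab

theorem Good.bind {r : Filter U} (hr : Good L M r) {Ω : U → Prop} (hΩd : Def L (univ : Set M) Ω)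
    (hΩ : ∀ᶠ u in r, Ω u) {q : U → Filter X} (hq : ∀ u, Ω u → Good L M (q u))
    (hfam : UFam L M q) : Good L M (Filter.bind r q) where
  neBot := by
    have := hr.neBot
    constructor
    intro hbot
    have h1 : ∀ᶠ x in Filter.bind r q, False := by
      rw [hbot]
      trivial
    rw [eventually_bind] at h1
    obtain ⟨u, h2, h3⟩ := (h1.and hΩ).exists
    have := (hq u h3).neBot
    exact h2.exists.elim fun _ h => h
  ultra := fun P hP => by
    simp only [eventually_bind]
    have hP := hP.c1
    have hfam := hfam.use
    rcases hr.ultra (fun u => ∀ᶠ x in q u, P x) Def.auto with h | h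
    · exact Or.inl h
    · right
      filter_upwards [h, hΩ] with u h1 h2
      exact ((hq u h2).ultra P (hP _ _ DMap.id)).resolve_left h1
  tame := fun W hW hfin a b hab => by
    have := hr.neBot
    have hW := hW.c2
    have hfam := hfam.use
    have hΩd := hΩd.c1
    obtain ⟨W', hW'⟩ : ∃ W' : U → M → Prop, W' = fun u v => Ω u ∧ (a < v ∧ v < b) ∧
      ∀ v1 v2, v1 < v → v < v2 → ∀ᶠ x in q u, ∃ y, v1 < y ∧ y < v2 ∧ W x y := ⟨_, rfl⟩
    have hWd : Def L (univ : Set M) (fun z : U × M => W' z.1 z.2) := by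
      rw [hW']
      exact Def.auto
    have hWd' := hWd.c2
    obtain ⟨v1, v2, h1, h2, h3, h4⟩ := hr.tame W' hWd (by
      intro u
      by_contra hinf
      obtain ⟨c, d, hcd, hall⟩ := exists_interval (L := L) (P := fun y => W' u y) Def.auto hinf
      obtain ⟨v0, h1, h2⟩ := exists_between hcd
      have hΩu : Ω u := by
        have := hall v0 h1 h2
        rw [hW'] at this
        exact this.1
      obtain ⟨v1, v2, h3, h4, h5, h6⟩ := (hq u hΩu).tame W Def.auto hfin c d hcd
      obtain ⟨v, h7, h8⟩ := exists_between h4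
      have := hall v (h3.trans_lt h7) (h8.trans_le h5)
      rw [hW'] at this
      exact h6 (this.2.2 v1 v2 h7 h8)) a b hab
    have h4 := (hr.ultra (fun u => ∃ y, v1 < y ∧ y < v2 ∧ W' u y) Def.auto).resolve_left h4
    obtain ⟨w1, h5, h6⟩ := exists_between h2
    obtain ⟨w2, h7, h8⟩ := exists_between h6
    refine ⟨w1, w2, h1.trans h5.le, h7, h8.le.trans h3, fun hcon => ?_⟩
    rw [eventually_bind] at hcon
    obtain ⟨u, ⟨h9, h10⟩, h11⟩ := ((hcon.and h4).and hΩ).exists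
    have hgu := hq u h11
    have := hgu.neBot
    obtain ⟨e, h12, h13, h14⟩ := conn' (L := L)
      (P := fun v => ∀ᶠ x in q u, ∃ y, w1 < y ∧ y < v ∧ W x y) Def.auto h7.le (by
        intro hiff
        obtain ⟨x, y, hy1, hy2, -⟩ := (hiff.2 h9).exists
        exact lt_asymm hy1 hy2)
    have h15 : ¬ W' u e := fun h => h10 ⟨e, h5.trans_le h12, h13.trans_lt h8, h⟩
    rw [hW'] at h15
    have h16 : ∃ c1 c2, c1 < e ∧ e < c2 ∧ ¬ ∀ᶠ x in q u, ∃ y, c1 < y ∧ y < c2 ∧ W x y := by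
      by_contra h16
      push Not at h16
      exact h15 ⟨h11, ⟨(h1.trans_lt h5).trans_le h12, (h13.trans_lt h8).trans_le h3⟩, h16⟩
    obtain ⟨c1, c2, h17, h18, h19⟩ := h16
    have h19 := (hgu.ultra (fun x => ∃ y, c1 < y ∧ y < c2 ∧ W x y) Def.auto).resolve_left h19
    obtain ⟨z, h20, h21, h22⟩ := h14 c1 c2 h17 h18
    apply h22
    refine eventually_congr ?_
    filter_upwards [h19] with x hx
    constructor
    · rintro ⟨y, hy1, hy2, hy3⟩
      refine ⟨y, hy1, ?_, hy3⟩
      by_contra hlt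
      exact hx ⟨y, h17.trans_le (not_lt.1 hlt), hy2.trans h21, hy3⟩
    · rintro ⟨y, hy1, hy2, hy3⟩
      refine ⟨y, hy1, ?_, hy3⟩
      by_contra hlt
      exact hx ⟨y, h20.trans_le (not_lt.1 hlt), hy2.trans h18, hy3⟩

theorem chain_const {Q : M → M → Prop} (hQ : Def L (univ : Set M) (fun z : M × M => Q z.1 z.2))
    {a b : M} (hab : a < b) (hne : ∀ t, a < t → t < b → ∃ d, Q t d)
    (htot : ∀ t t', (∀ y, Q t y → Q t' y) ∨ (∀ y, Q t' y → Q t y)) :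
    ∃ d c c', a ≤ c ∧ c < c' ∧ c' ≤ b ∧ ∀ t, c < t → t < c' → Q t d := by
  obtain ⟨a', b', h1, h2, h3, h4⟩ := mono_family (L := L) hQ hab htot
  obtain ⟨t0, h5, h6⟩ := exists_between h2
  obtain ⟨d, hd⟩ := hne t0 (h1.trans_lt h5) (h6.trans_le h3)
  rcases h4 with h4 | h4
  · exact ⟨d, t0, b', h1.trans h5.le, h6, h3, fun t h7 h8 => h4 t0 t h5 h7 h8 d hd⟩
  · exact ⟨d, a', t0, h1, h5, h6.le.trans h3, fun t h7 h8 => h4 t t0 h7 h8 h6 d hd⟩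

theorem Good.of_chain {p : Filter M} {D : M → Prop} {C : M → M → Prop}
    (hD : Def L (univ : Set M) D) (hC : Def L (univ : Set M) (fun z : M × M => C z.1 z.2))
    (hp : ∀ P : M → Prop, (∀ᶠ z in p, P z) ↔ ∃ d, D d ∧ ∀ z, C d z → P z)
    (hne : ∀ d, D d → ∃ z, C d z)
    (hch : ∀ d d', D d → D d' → (∀ z, C d z → C d' z) ∨ (∀ z, C d' z → C d z))
    (hu : ∀ P : M → Prop, Def L (univ : Set M) P → (∀ᶠ x in p, P x) ∨ (∀ᶠ x in p, ¬ P x)) :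
    Good L M p := by
  have hnb : p.NeBot := by
    constructor
    intro hbot
    have h1 : ∀ᶠ x in p, False := by
      rw [hbot]
      trivial
    obtain ⟨d, h2, h3⟩ := (hp _).1 h1
    obtain ⟨z, hz⟩ := hne d h2
    exact h3 z hz
  refine ⟨hnb, hu, fun W hW hfin a b hab => ?_⟩
  have hW := hW.c2
  have hC := hC.c2
  have hD := hD.c1
  have tot : ∀ V : M → M → Prop, ∀ t t',
      (∀ d, (D d ∧ ∀ z, C d z → V z t) → (D d ∧ ∀ z, C d z → V z t')) ∨
      (∀ d, (D d ∧ ∀ z, C d z → V z t') → (D d ∧ ∀ z, C d z → V z t)) := by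
    intro V t t'
    by_contra hcon
    push Not at hcon
    obtain ⟨⟨d, ⟨h1, h2⟩, h3⟩, d', ⟨h4, h5⟩, h6⟩ := hcon
    obtain ⟨z, hz, hz'⟩ := h3 h1
    obtain ⟨w, hw, hw'⟩ := h6 h4
    rcases hch d d' h1 h4 with h | h
    · exact hz' (h5 z (h z hz))
    · exact hw' (h2 w (h w hw))
  obtain ⟨a', b', h1, h2, h3, h4⟩ := exists_sub (L := L)
    (P := fun y => ∃ d, D d ∧ ∀ z, C d z → W z y) Def.auto hab
  rcases h4 with h4 | h4
  · exfalso
    obtain ⟨d, c, c', h5, h6, h7, h8⟩ := chain_const (L := L)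
      (Q := fun y d => D d ∧ ∀ z, C d z → W z y) Def.auto h2 h4 (tot W)
    obtain ⟨t, h9, h10⟩ := exists_between h6
    obtain ⟨z, hz⟩ := hne d (h8 t h9 h10).1
    exact Set.Ioo_infinite h6 ((hfin z).subset fun y hy => (h8 y hy.1 hy.2).2 z hz)
  · have h4' : ∀ y, a' < y → y < b' → ∃ d, D d ∧ ∀ z, C d z → ¬ W z y := by
      intro y h5 h6
      rcases hu (fun z => W z y) Def.auto with h | h
      · exact absurd ((hp _).1 h) (h4 y h5 h6)
      · exact (hp _).1 h
    obtain ⟨d, c, c', h5, h6, h7, h8⟩ := chain_const (L := L)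
      (Q := fun y d => D d ∧ ∀ z, C d z → ¬ W z y) Def.auto h2 h4' (tot fun z y => ¬ W z y)
    refine ⟨c, c', h1.trans h5, h6, h7.trans h3, fun hev => ?_⟩
    obtain ⟨t, h9, h10⟩ := exists_between h6
    have hd := (h8 t h9 h10).1
    have hev' : ∀ᶠ z in p, C d z := (hp _).2 ⟨d, hd, fun z hz => hz⟩
    obtain ⟨z, ⟨y, h11, h12, h13⟩, h14⟩ := (hev.and hev').exists
    exact (h8 y h11 h12).2 z h14 h13

theorem Good.lowEnd {D : M → Prop} (hD : Def L (univ : Set M) D) (hne : ∃ d, D d) :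
    Good L M (OM.lowEnd D) := by
  have hD' := hD.c1
  refine Good.of_chain (D := D) (C := fun d z => D z ∧ z ≤ d) hD Def.auto ?_ ?_ ?_ ?_
  · intro P
    rw [eventually_lowEnd]
    constructor
    · intro h
      obtain ⟨d, h1, h2⟩ := h hne
      exact ⟨d, h1, fun z hz => h2 z hz.1 hz.2⟩
    · rintro ⟨d, h1, h2⟩ -
      exact ⟨d, h1, fun z h3 h4 => h2 z ⟨h3, h4⟩⟩
  · exact fun d hd => ⟨d, hd, le_rfl⟩
  · intro d d' _ _
    rcases le_total d d' with h | h
    · exact Or.inl fun z hz => ⟨hz.1, hz.2.trans h⟩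
    · exact Or.inr fun z hz => ⟨hz.1, hz.2.trans h⟩
  · intro P hP
    obtain ⟨E, hE⟩ := exists_ctl hP
    obtain ⟨d, h1, h2⟩ := endUltra E D P hE hne
    rcases h2 with h2 | h2
    · exact Or.inl fun _ => ⟨d, h1, h2⟩
    · exact Or.inr fun _ => ⟨d, h1, h2⟩

theorem Good.highEnd {D : M → Prop} (hD : Def L (univ : Set M) D) (hne : ∃ d, D d) :
    Good L M (OM.highEnd D) := by
  have hD' := hD.c1
  refine Good.of_chain (D := D) (C := fun d z => D z ∧ d ≤ z) hD Def.auto ?_ ?_ ?_ ?_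
  · intro P
    rw [eventually_highEnd]
    constructor
    · intro h
      obtain ⟨d, h1, h2⟩ := h hne
      exact ⟨d, h1, fun z hz => h2 z hz.1 hz.2⟩
    · rintro ⟨d, h1, h2⟩ -
      exact ⟨d, h1, fun z h3 h4 => h2 z ⟨h3, h4⟩⟩
  · exact fun d hd => ⟨d, hd, le_rfl⟩
  · intro d d' _ _
    rcases le_total d d' with h | h
    · exact Or.inr fun z hz => ⟨hz.1, h.trans hz.2⟩
    · exact Or.inl fun z hz => ⟨hz.1, h.trans hz.2⟩
  · intro P hP
    obtain ⟨E, hE⟩ := exists_ctl hP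
    obtain ⟨d, h1, h2⟩ := endUltra' E D P hE hne
    rcases h2 with h2 | h2
    · exact Or.inl fun _ => ⟨d, h1, h2⟩
    · exact Or.inr fun _ => ⟨d, h1, h2⟩

end GoodFilters

end OM



set_option linter.unusedSectionVars false

namespace OM

open Filter

section Rho

variable {M : Type u} [LinearOrder M]

/-- Stability of a cofinal segment of a preorder. -/
def stable (D : M → Prop) (le : M → M → Prop) (v0 : M) : Prop :=
  D v0 ∧ ∀ v, D v → le v0 v → ∀ y, (∃ w, (D w ∧ le v0 w) ∧ w ≤ y) → ∃ w, (D w ∧ le v w) ∧ w ≤ y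

/-- Points below some cofinal segment. -/
def belowSet (D : M → Prop) (le : M → M → Prop) (y : M) : Prop :=
  ∃ v, D v ∧ ∀ w, (D w ∧ le v w) → y < w

/-- One-dimensional cofinal filter of a definable preorder. -/
def rho (D : M → Prop) (le : M → M → Prop) : Filter M :=
  (⨆ v0, ⨆ (_ : stable D le v0), lowEnd (fun w => D w ∧ le v0 w)) ⊔
    ⨆ (_ : ¬ ∃ v0, stable D le v0), highEnd (belowSet D le)

theorem eventually_rho {D : M → Prop} {le : M → M → Prop} {P : M → Prop} :
    (∀ᶠ y in rho D le, P y) ↔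
      (∀ v0, stable D le v0 → ∀ᶠ y in lowEnd (fun w => D w ∧ le v0 w), P y) ∧
      ((¬ ∃ v0, stable D le v0) → ∀ᶠ y in highEnd (belowSet D le), P y) := by
  unfold rho
  rw [eventually_sup, eventually_iSup, eventually_iSup]
  simp only [eventually_iSup]

variable {L : FirstOrder.Language} [L.Structure M] [OMin L M]
  [DenselyOrdered M] [NoMinOrder M] [NoMaxOrder M]

variable {D : M → Prop} {le : M → M → Prop}

theorem lowEnd_eq_of_stable (hD : Def L (univ : Set M) D)
    (hle : Def L (univ : Set M) (fun z : M × M => le z.1 z.2))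
    (htot : ∀ u v, D u → D v → le u v ∨ le v u)
    (htr : ∀ u v w, D u → D v → D w → le u v → le v w → le u w)
    {v0 v1 : M} (h0 : stable D le v0) (h1 : D v1) (h01 : le v0 v1) :
    lowEnd (fun w => D w ∧ le v0 w) = lowEnd (fun w => D w ∧ le v1 w) := by
  have hD := hD.c1
  have hle := hle.c2
  have hself : ∀ v, D v → le v v := fun v hv => (htot v v hv hv).elim _root_.id _root_.id
  have hsub : ∀ w, D w ∧ le v1 w → D w ∧ le v0 w := fun w hw =>
    ⟨hw.1, htr v0 v1 w h0.1 h1 hw.1 h01 hw.2⟩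
  have ht : ∀ P : M → Prop, (∀ᶠ y in lowEnd (fun w => D w ∧ le v0 w), P y) →
      ∀ᶠ y in lowEnd (fun w => D w ∧ le v1 w), P y := by
    intro P hP
    rw [eventually_lowEnd] at hP ⊢
    intro _
    obtain ⟨d, hd, h⟩ := hP ⟨v0, h0.1, hself v0 h0.1⟩
    obtain ⟨w, hw, hwd⟩ := h0.2 v1 h1 h01 d ⟨d, hd, le_rfl⟩
    exact ⟨w, hw, fun y hy hyw => h y (hsub y hy) (hyw.trans hwd)⟩
  have hg0 : Good L M (lowEnd (fun w => D w ∧ le v0 w)) :=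
    Good.lowEnd Def.auto ⟨v0, h0.1, hself v0 h0.1⟩
  have hg1 : Good L M (lowEnd (fun w => D w ∧ le v1 w)) :=
    Good.lowEnd Def.auto ⟨v1, h1, hself v1 h1⟩
  have hself1 : ∀ᶠ y in lowEnd (fun w => D w ∧ le v1 w), D y ∧ le v1 y := by
    rw [eventually_lowEnd]
    rintro ⟨d, hd⟩
    exact ⟨d, hd, fun y hy _ => hy⟩
  have hev : ∀ᶠ y in lowEnd (fun w => D w ∧ le v0 w), D y ∧ le v1 y := by
    rcases hg0.ultra (fun y => D y ∧ le v1 y) Def.auto with h | h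
    · exact h
    · have := hg1.neBot
      obtain ⟨y, hy, hy'⟩ := ((ht _ h).and hself1).exists
      exact absurd hy' hy
  apply Filter.ext'
  intro P
  refine ⟨ht P, fun hP => ?_⟩
  rw [eventually_lowEnd] at hP
  obtain ⟨d, hd, h⟩ := hP ⟨v1, h1, hself v1 h1⟩
  have : ∀ᶠ y in lowEnd (fun w => D w ∧ le v0 w), y ≤ d := by
    rw [eventually_lowEnd]
    intro _
    exact ⟨d, hsub d hd, fun y _ h => h⟩
  filter_upwards [this, hev] with y h2 h3
  exact h y h3 h2

theorem rho_spec (hD : Def L (univ : Set M) D)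
    (hle : Def L (univ : Set M) (fun z : M × M => le z.1 z.2))
    (htot : ∀ u v, D u → D v → le u v ∨ le v u)
    (htr : ∀ u v w, D u → D v → D w → le u v → le v w → le u w) (hne : ∃ d, D d) :
    Good L M (rho D le) ∧ ∀ v, D v → ∀ᶠ w in rho D le, D w ∧ le v w := by
  have hD2 := hD.c1
  have hle2 := hle.c2
  have hself : ∀ v, D v → le v v := fun v hv => (htot v v hv hv).elim _root_.id _root_.id
  have hselfev : ∀ v, ∀ᶠ y in lowEnd (fun w => D w ∧ le v w), D y ∧ le v y := by
    intro v
    rw [eventually_lowEnd]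
    rintro ⟨d, hd⟩
    exact ⟨d, hd, fun y hy _ => hy⟩
  by_cases hs : ∃ v0, stable D le v0
  · obtain ⟨v0, h0⟩ := hs
    have heq : rho D le = lowEnd (fun w => D w ∧ le v0 w) := by
      apply Filter.ext'
      intro P
      rw [eventually_rho]
      constructor
      · exact fun h => h.1 v0 h0
      · intro h
        refine ⟨fun v1 h1 => ?_, fun h' => absurd ⟨v0, h0⟩ h'⟩
        rcases htot v0 v1 h0.1 h1.1 with h2 | h2
        · rwa [← lowEnd_eq_of_stable hD hle htot htr h0 h1.1 h2]
        · rwa [lowEnd_eq_of_stable hD hle htot htr h1 h0.1 h2]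
    rw [heq]
    refine ⟨Good.lowEnd Def.auto ⟨v0, h0.1, hself v0 h0.1⟩, fun v hv => ?_⟩
    rcases htot v0 v h0.1 hv with h2 | h2
    · rw [lowEnd_eq_of_stable hD hle htot htr h0 hv h2]
      exact hselfev v
    · filter_upwards [hselfev v0] with w hw
      exact ⟨hw.1, htr v v0 w hv h0.1 hw.1 h2 hw.2⟩
  · have heq : rho D le = highEnd (belowSet D le) := by
      apply Filter.ext'
      intro P
      rw [eventually_rho]
      constructor
      · exact fun h => h.2 hs
      · exact fun h => ⟨fun v hv => absurd ⟨v, hv⟩ hs, fun _ => h⟩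
    have huns : ∀ v, D v → ∃ v', D v' ∧ le v v' ∧ ∃ y, (∃ w, (D w ∧ le v w) ∧ w ≤ y) ∧
        ∀ w, (D w ∧ le v' w) → y < w := by
      intro v hv
      by_contra hcon
      apply hs
      refine ⟨v, hv, fun v' hv' hvv' y hy => ?_⟩
      by_contra hcon'
      apply hcon
      refine ⟨v', hv', hvv', y, hy, fun w hw => ?_⟩
      by_contra hlt
      exact hcon' ⟨w, hw, not_lt.1 hlt⟩
    have hBne : ∃ y, belowSet D le y := by
      obtain ⟨v, hv⟩ := hne
      obtain ⟨v', hv', -, y, -, h⟩ := huns v hv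
      exact ⟨y, v', hv', h⟩
    have hg : Good L M (highEnd (belowSet D le)) := by
      apply Good.highEnd _ hBne
      unfold belowSet
      exact Def.auto
    rw [heq]
    refine ⟨hg, fun v hv => ?_⟩
    refine (hg.ultra (fun w => D w ∧ le v w) Def.auto).resolve_right fun hno => ?_
    rw [eventually_highEnd] at hno
    obtain ⟨b, ⟨v1, hv1, hb1⟩, hb⟩ := hno hBne
    obtain ⟨v', hv', hvv', hv1v'⟩ : ∃ v', D v' ∧ le v v' ∧ le v1 v' := by
      rcases htot v v1 hv hv1 with h | h
      · exact ⟨v1, hv1, h, hself v1 hv1⟩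
      · exact ⟨v, hv, hself v hv, h⟩
    obtain ⟨v'', hv'', -, g, ⟨y, hy, hyg⟩, hg⟩ := huns v' hv'
    refine hb y ⟨v'', hv'', fun w hw => hyg.trans_lt (hg w hw)⟩
      (hb1 y ⟨hy.1, htr v1 v' y hv1 hv' hy.1 hv1v' hy.2⟩).le
      ⟨hy.1, htr v v' y hv hv' hy.1 hvv' hy.2⟩

variable (L) in
/-- Cofinal definable filters for total preorders. -/
def RFor (A : Set M) (X : Type u) [Tup M X] : Prop :=
  ∀ (Ω : X → Prop) (le : X → X → Prop), Def L A Ω → Def L A (fun z : X × X => le z.1 z.2) →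
    (∀ u v, Ω u → Ω v → le u v ∨ le v u) →
    (∀ u v w, Ω u → Ω v → Ω w → le u v → le v w → le u w) → (∃ u, Ω u) →
    ∃ r : Filter X, DF L A r ∧ Good L M r ∧ ∀ u, Ω u → ∀ᶠ u' in r, Ω u' ∧ le u u'

theorem DF_unit {A : Set M} : DF L A (pure PUnit.unit : Filter PUnit.{u+1}) := by
  intro B _ Z _ P hP
  simp only [eventually_pure]
  have hP := hP.c2
  exact hP _ _ _ DMap.id DMap.star

theorem R_unit {A : Set M} : RFor L A PUnit.{u+1} := by
  intro Ω le hΩ hle htot htr hne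
  obtain ⟨⟨⟩, hu⟩ := hne
  refine ⟨pure PUnit.unit, DF_unit, Good.pure _, ?_⟩
  rintro ⟨⟩ _
  rw [eventually_pure]
  exact ⟨hu, (htot _ _ hu hu).elim _root_.id _root_.id⟩

theorem rho_def {A B : Set M} {X : Type u} [Tup M X] {Ω : X × M → Prop} {le : X × M → X × M → Prop}
    (hAB : A ⊆ B) (hΩ : Def L A Ω) (hle : Def L A (fun z : (X × M) × (X × M) => le z.1 z.2))
    {Z : Type u} [Tup M Z] {P : Z → M → Prop} (f : Z → X) (hf : DMap L B f)
    (hP : Def L B (fun w : Z × M => P w.1 w.2)) :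
    Def L B (fun z => ∀ᶠ y in rho (fun y => Ω (f z, y)) (fun y y' => le (f z, y) (f z, y')), P z y) := by
  have hΩ := (hΩ.mono hAB).c1
  have hle := (hle.mono hAB).c2
  have hf := hf.c1
  have hP := hP.c2
  simp only [eventually_rho, eventually_lowEnd, eventually_highEnd, stable, belowSet]
  exact Def.auto

theorem R_step {A : Set M} {X : Type u} [Tup M X] (hX : RFor L A X) : RFor L A (X × M) := by
  intro Ω le hΩ hle htot htr hne
  have hΩ2 := hΩ.c1
  have hle2 := hle.c2
  have hΩu := (hΩ.mono (Set.subset_univ A)).c1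
  have hleu := (hle.mono (Set.subset_univ A)).c2
  obtain ⟨r, hr1, hr2, hr3⟩ := hX (fun x => ∃ y, Ω (x, y))
    (fun x x' => ∀ y, Ω (x, y) → ∃ y', Ω (x', y') ∧ le (x, y) (x', y')) Def.auto Def.auto (by
      rintro x x' - -
      by_contra hcon
      push Not at hcon
      obtain ⟨⟨y, h1, h2⟩, y', h3, h4⟩ := hcon
      rcases htot _ _ h1 h3 with h | h
      · exact h2 y' h3 h
      · exact h4 y h1 h) (by
      rintro x x' x'' - - - h h' y hy
      obtain ⟨y', h1, h2⟩ := h y hy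
      obtain ⟨y'', h3, h4⟩ := h' y' h1
      exact ⟨y'', h3, htr _ _ _ hy h1 h3 h2 h4⟩) (by
      obtain ⟨⟨x, y⟩, h⟩ := hne
      exact ⟨x, y, h⟩)
  have hspec : ∀ x, (∃ y, Ω (x, y)) →
      Good L M (rho (fun y => Ω (x, y)) (fun y y' => le (x, y) (x, y'))) ∧
      ∀ v, Ω (x, v) → ∀ᶠ w in rho (fun y => Ω (x, y)) (fun y y' => le (x, y) (x, y')),
        Ω (x, w) ∧ le (x, v) (x, w) := by
    intro x hx
    exact rho_spec (L := L) (D := fun y => Ω (x, y)) (le := fun y y' => le (x, y) (x, y'))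
      Def.auto Def.auto (fun u v hu hv => htot _ _ hu hv)
      (fun u v w hu hv hw => htr _ _ _ hu hv hw) hx
  refine ⟨Filter.bind r (fun x => Filter.map (Prod.mk x)
    (rho (fun y => Ω (x, y)) (fun y y' => le (x, y) (x, y')))), ?_, ?_, ?_⟩
  · intro B hAB Z _ P hP
    simp only [eventually_bind, eventually_map]
    have hP := hP.c2
    refine hr1 B hAB Z _ ?_
    exact rho_def hAB hΩ hle (fun w : Z × X => w.2) DMap.id.snd Def.auto
  · refine hr2.bind (Ω := fun x => ∃ y, Ω (x, y)) Def.auto ?_ ?_ ?_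
    · obtain ⟨⟨x, y⟩, h⟩ := hne
      exact (hr3 x ⟨y, h⟩).mono fun x' h => h.1
    · intro x hx
      exact (hspec x hx).1.map ((DMap.cst x).pair DMap.id)
    · intro Z _ P hP
      simp only [eventually_map]
      have hP := hP.c2
      exact rho_def (Set.subset_univ A) hΩ hle (fun w : Z × X => w.2) DMap.id.snd Def.auto
  · rintro ⟨x0, y0⟩ h0
    rw [eventually_bind]
    filter_upwards [hr3 x0 ⟨y0, h0⟩] with x hx
    rw [eventually_map]
    obtain ⟨y, h1, h2⟩ := hx.2 y0 h0
    filter_upwards [(hspec x hx.1).2 y h1] with w hw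
    exact ⟨hw.1, htr _ _ _ h0 h1 hw.1 h2 hw.2⟩

theorem R_pw (A : Set M) : ∀ n, RFor L A (Pw M n)
  | 0 => R_unit
  | n + 1 => R_step (R_pw A n)

end Rho

end OM



set_option linter.unusedSectionVars false

namespace OM

open Filter

section MainPart

variable {L : FirstOrder.Language} {M : Type u} [L.Structure M] [LinearOrder M] [OMin L M]
  [DenselyOrdered M] [NoMinOrder M] [NoMaxOrder M]
variable {X : Type u} [Tup M X]

theorem finClasses_ev {p : Filter X} (hp : Good L M p) (hpd : DF L (univ : Set M) p) {m : ℕ}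
    {G : Pw M m → X → M → Prop} {E : X → M → Prop}
    (hG : Def L (univ : Set M) (fun z : Pw M m × X × M => G z.1 z.2.1 z.2.2))
    (hE : Def L (univ : Set M) (fun z : X × M => E z.1 z.2)) (hfin : ∀ x, {e | E x e}.Finite) :
    FinClasses (fun u u' => ∀ᶠ x in p, ∀ e, E x e → (G u x e ↔ G u' x e)) := by
  by_contra hcon
  have hG2 := hG.c3
  have hE2 := hE.c2
  have hUU : (univ : Set M) ⊆ univ := Set.Subset.refl _
  obtain ⟨a, b, γ, hab, hγ, h⟩ := curve_pw m
    (fun u u' => ∀ᶠ x in p, ∀ e, E x e → (G u x e ↔ G u' x e)) Def.auto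
    (fun u => Eventually.of_forall fun x e _ => Iff.rfl)
    (fun u u' h => h.mono fun x hx e he => (hx e he).symm)
    (fun u u' u'' h h' => (h.and h').mono fun x hx e he => (hx.1 e he).trans (hx.2 e he)) hcon
  have hγ2 := hγ.c1
  have hb : Def L (univ : Set M) (fun z : (X × M) × M => G (γ z.2) z.1.1 z.1.2) := Def.auto
  have hb2 := Def.bd (Z := M) (P := fun (z : X × M) t => G (γ t) z.1 z.2) hb
  have hb3 : ∀ (Z : Type u) [Tup M Z] (f : Z → X) (g k : Z → M), DMap L (univ : Set M) f →
      DMap L (univ : Set M) g → DMap L (univ : Set M) k →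
      Def L (univ : Set M) (fun z => bd (fun t => G (γ t) (f z) (g z)) (k z)) :=
    fun Z _ f g k hf hg hk => hb2 Z (fun z => (f z, g z)) k (hf.pair hg) hk
  have hWd : Def L (univ : Set M)
      (fun z : X × M => ∃ e, E z.1 e ∧ bd (fun t => G (γ t) z.1 e) z.2) := by
    refine Def.ex (Def.and Def.auto ?_)
    exact hb3 _ _ _ _ DMap.id.fst.fst DMap.id.snd DMap.id.fst.snd
  obtain ⟨v1, v2, h1, h2, h3, h4⟩ := hp.tame
    (fun x t => ∃ e, E x e ∧ bd (fun t => G (γ t) x e) t) hWd (by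
      intro x
      have : {y | ∃ e, E x e ∧ bd (fun t => G (γ t) x e) y} =
          ⋃ e ∈ {e | E x e}, {y | bd (fun t => G (γ t) x e) y} := by
        ext y
        simp
      rw [this]
      refine (hfin x).biUnion fun e _ => finite_bd (L := L) Def.auto) a b hab
  have hWd2 := hWd.c2 (P := fun x t => ∃ e, E x e ∧ bd (fun t => G (γ t) x e) t)
  have h5 := (hp.ultra
    (fun x => ∃ y, v1 < y ∧ y < v2 ∧ ∃ e, E x e ∧ bd (fun t => G (γ t) x e) y) (by
      refine Def.ex (Def.and Def.auto (Def.and Def.auto ?_))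
      exact hWd2 _ _ _ DMap.id.fst DMap.id.snd)).resolve_left h4
  obtain ⟨t, ht1, ht2⟩ := exists_between h2
  obtain ⟨t', ht3, ht4⟩ := exists_between ht2
  refine h t t' (h1.trans_lt ht1) ht3 (ht4.trans_le h3) ?_
  filter_upwards [h5] with x hx e he
  refine conn (L := L) (P := fun t => G (γ t) x e) Def.auto ht3.le fun s hs1 hs2 hbd => ?_
  exact hx ⟨s, ht1.trans_le hs1, hs2.trans_lt ht4, e, he, hbd⟩

/-- The combinatorial heart of the extension step, at one point of the base. -/
theorem fiber_contra {D1 D2 D3 X' : M → Prop} (hX' : Def L (univ : Set M) X')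
    (h21 : ∀ y, D2 y → D1 y ∧ X' y) (hne2 : ∃ y, D2 y) {d1 d3 : M} (hd1 : D1 d1)
    (hd1' : ∀ y, D1 y → y ≤ d1 → ¬ X' y) (hd3 : D3 d3) (hd3' : ∀ y, D3 y → y ≤ d3 → ¬ X' y)
    (h32 : ∀ y, (∃ y', y' ≤ y ∧ D3 y') → ∃ y', y' ≤ y ∧ D2 y')
    (h13 : ∀ e, bd X' e → (∃ y', y' ≤ e ∧ D1 y') → ∃ y', y' ≤ e ∧ D3 y') : False := by
  have hgt : ∀ y, D2 y → d1 < y := by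
    intro y hy
    by_contra hlt
    exact hd1' y (h21 y hy).1 (not_lt.1 hlt) (h21 y hy).2
  have hnx : ¬ X' d1 := hd1' d1 hd1 le_rfl
  obtain ⟨y2, hy2⟩ := hne2
  obtain ⟨e0, he0, -, hbd0⟩ := conn' hX' (hgt y2 hy2).le
    (fun h => hnx (h.2 (h21 y2 hy2).2))
  have hfin : {e | bd X' e ∧ d1 ≤ e}.Finite := (finite_bd hX').subset fun e he => he.1
  obtain ⟨e, ⟨he1, he2⟩, hmin⟩ := Set.exists_min_image _ (fun e => e) hfin ⟨e0, hbd0, he0⟩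
  obtain ⟨y3, hy3e, hy3⟩ := h13 e he1 ⟨d1, he2, hd1⟩
  have hmem : D3 (min y3 d3) := by
    rcases min_choice y3 d3 with h | h <;> rw [h] <;> assumption
  have hnot : ¬ X' (min y3 d3) := hd3' _ hmem (min_le_right _ _)
  obtain ⟨y4, hy4, hy4'⟩ := h32 _ ⟨min y3 d3, le_rfl, hmem⟩
  have hle : y4 ≤ e := hy4.trans ((min_le_left _ _).trans hy3e)
  rcases hle.lt_or_eq with hlt | heq
  · obtain ⟨e', h1, h2, h3⟩ := conn' hX' (hgt y4 hy4').le
      (fun h => hnx (h.2 (h21 y4 hy4').2))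
    exact absurd (hmin e' ⟨h3, h1⟩) (not_le.2 (h2.trans_lt hlt))
  · apply hnot
    have : min y3 d3 = y4 := le_antisymm (((min_le_left _ _).trans hy3e).trans heq.ge) hy4
    rw [this]
    exact (h21 y4 hy4').2

theorem exists_class {U : Type u} [Tup M U] {r : Filter U} (hr : Good L M r)
    {E : U → U → Prop} (hE : Def L (univ : Set M) (fun z : U × U => E z.1 z.2))
    (hfc : FinClasses E) : ∃ f, ∀ᶠ u in r, E f u := by
  obtain ⟨F, hF, h⟩ := hfc
  have hE := hE.c2
  have := hr.neBot
  by_contra hcon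
  rw [not_exists] at hcon
  have h1 : ∀ f ∈ F, ∀ᶠ u in r, ¬ E f u := fun f _ =>
    (hr.ultra (fun u => E f u) Def.auto).resolve_left (hcon f)
  have h2 := (Filter.eventually_all_finite hF).2 h1
  obtain ⟨u, hu⟩ := h2.exists
  obtain ⟨f, hf, hfu⟩ := h u
  exact hu f hf hfu

variable (L) in
/-- The main extension property. -/
def MainFor (A : Set M) (X : Type u) [Tup M X] : Prop :=
  ∀ (m : ℕ) (Ω : Pw M m → Prop) (D : Pw M m → X → Prop), Def L A Ω →
    Def L A (fun z : Pw M m × X => D z.1 z.2) → (∃ u, Ω u) → (∀ u, Ω u → ∃ x, D u x) →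
    (∀ u u', Ω u → Ω u' → ∃ u'', Ω u'' ∧ ∀ x, D u'' x → D u x ∧ D u' x) →
    ∃ p : Filter X, DF L A p ∧ Good L M p ∧ ∀ u, Ω u → ∀ᶠ x in p, D u x

theorem main_unit (A : Set M) : MainFor L A PUnit.{u+1} := by
  intro m Ω D hΩ hD hne hfib hdir
  refine ⟨pure PUnit.unit, DF_unit, Good.pure _, fun u hu => ?_⟩
  rw [eventually_pure]
  obtain ⟨⟨⟩, h⟩ := hfib u hu
  exact h

theorem DF.mono {A B : Set M} {p : Filter X} (h : DF L A p) (hAB : A ⊆ B) : DF L B p :=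
  fun C hC => h C (hAB.trans hC)

theorem main_step {A : Set M} (hX : MainFor L A X) : MainFor L A (X × M) := by
  intro m Ω D hΩ hD hne hfib hdir
  have hΩ2 := hΩ.c1
  have hD2 := hD.c2
  have hΩu := (hΩ.mono (Set.subset_univ A)).c1
  have hDu := (hD.mono (Set.subset_univ A)).c2
  obtain ⟨p, hp1, hp2, hp3⟩ := hX m Ω (fun u x => ∃ y, D u (x, y)) hΩ Def.auto hne
    (fun u hu => by
      obtain ⟨⟨x, y⟩, h⟩ := hfib u hu
      exact ⟨x, y, h⟩)
    (fun u u' hu hu' => by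
      obtain ⟨u'', h1, h2⟩ := hdir u u' hu hu'
      exact ⟨u'', h1, fun x ⟨y, hy⟩ => ⟨⟨y, (h2 _ hy).1⟩, ⟨y, (h2 _ hy).2⟩⟩⟩)
  have hAA : A ⊆ A := Set.Subset.refl _
  have hAU : A ⊆ (univ : Set M) := Set.subset_univ _
  have hpA := hp1.use (Set.Subset.refl _)
  have hpu := hp1.use (Set.subset_univ A)
  have hpnb := hp2.neBot
  obtain ⟨r, hr1, hr2, hr3⟩ := R_pw (L := L) A m Ω
    (fun u u' => ∀ᶠ x in p, ∀ y, (∃ y', y' ≤ y ∧ D u' (x, y')) → ∃ y', y' ≤ y ∧ D u (x, y'))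
    hΩ Def.auto (by
      intro u v hu hv
      rcases hp2.ultra (fun x => ∀ y, (∃ y', y' ≤ y ∧ D v (x, y')) → ∃ y', y' ≤ y ∧ D u (x, y'))
        Def.auto with h | h
      · exact Or.inl h
      · right
        filter_upwards [h] with x hx y hy
        push Not at hx
        obtain ⟨y1, ⟨y2, h1, h2⟩, h3⟩ := hx
        obtain ⟨y', h4, h5⟩ := hy
        have : y1 < y' := by
          by_contra hlt
          exact h3 y' (not_lt.1 hlt) h5
        exact ⟨y2, h1.trans (this.le.trans h4), h2⟩) (by
      intro u v w hu hv hw h h'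
      filter_upwards [h, h'] with x hx hx' y hy
      exact hx y (hx' y hy)) hne
  have hrnb := hr2.neBot
  have hrΩ : ∀ᶠ u in r, Ω u := by
    obtain ⟨u, hu⟩ := hne
    exact (hr3 u hu).mono fun _ h => h.1
  have hmapgood : ∀ u x, (∃ y, D u (x, y)) →
      Good L M (Filter.map (Prod.mk x) (lowEnd fun y => D u (x, y))) := by
    intro u x hx
    exact (Good.lowEnd (L := L) (D := fun y => D u (x, y)) Def.auto hx).map
      ((DMap.cst x).pair DMap.id)
  have hpgood : ∀ u, Ω u → Good L M
      (Filter.bind p fun x => Filter.map (Prod.mk x) (lowEnd fun y => D u (x, y))) := by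
    intro u hu
    refine hp2.bind (Ω := fun x => ∃ y, D u (x, y)) Def.auto (hp3 u hu) (hmapgood u) ?_
    intro Z _ P hP
    have hP := hP.c2
    simp only [eventually_map, eventually_lowEnd]
    exact Def.auto
  have hqgood : Good L M (Filter.bind r fun u =>
      Filter.bind p fun x => Filter.map (Prod.mk x) (lowEnd fun y => D u (x, y))) := by
    refine hr2.bind (Ω := Ω) (hΩ.mono (Set.subset_univ A)) hrΩ hpgood ?_
    intro Z _ P hP
    have hP := hP.c2
    simp only [eventually_bind, eventually_map, eventually_lowEnd]
    exact Def.auto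
  refine ⟨_, ?_, hqgood, ?_⟩
  · intro B hAB Z _ P hP
    have hP := hP.c2
    have hD3 := (hD.mono hAB).c2
    have hpB := hp1.use hAB
    have hrB := hr1.use hAB
    clear hΩ2 hD2 hΩu hDu hpA hpu
    simp only [eventually_bind, eventually_map, eventually_lowEnd]
    exact Def.auto
  · intro u' hu'
    refine (hqgood.ultra (fun x => D u' x) Def.auto).resolve_right fun hno => ?_
    rw [eventually_bind] at hno
    have hbdA : Def L (univ : Set M) (fun z : X × M => bd (fun y => D u' (z.1, y)) z.2) := by
      have h0 : Def L (univ : Set M) (fun z : X × M => D u' (z.1, z.2)) := Def.auto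
      exact Def.bd (Z := M) (P := fun (x : X) y => D u' (x, y)) h0 _ _ _ DMap.id.fst DMap.id.snd
    have hfc := finClasses_ev hp2 (hp1.mono (Set.subset_univ A)) (m := m)
      (G := fun u x y => ∃ y', y' ≤ y ∧ D u (x, y'))
      (E := fun x e => bd (fun y => D u' (x, y)) e) Def.auto hbdA
      (fun x => finite_bd (L := L) Def.auto)
    have hbd2 := hbdA.c2 (P := fun x e => bd (fun y => D u' (x, y)) e)
    have hcl : Def L (univ : Set M) (fun z : Pw M m × Pw M m => ∀ᶠ x in p, ∀ e,
        bd (fun y => D u' (x, y)) e →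
        ((∃ y', y' ≤ e ∧ D z.1 (x, y')) ↔ ∃ y', y' ≤ e ∧ D z.2 (x, y'))) := by
      refine hpu _ _ ?_
      refine Def.all (Def.imp ?_ Def.auto)
      exact hbd2 _ _ _ DMap.id.fst.snd DMap.id.snd
    obtain ⟨f, hf⟩ := exists_class hr2 hcl hfc
    obtain ⟨u1, ⟨hu1, hf1⟩, hb1⟩ := ((hrΩ.and hf).and hno).exists
    obtain ⟨u2, hu2, h2⟩ := hdir u1 u' hu1 hu'
    obtain ⟨u3, ⟨⟨hu3, hle⟩, hf3⟩, hb3⟩ := (((hr3 u2 hu2).and hf).and hno).exists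
    rw [eventually_bind] at hb1 hb3
    obtain ⟨x, ⟨⟨⟨⟨⟨⟨hx1, hx2⟩, hx3⟩, hc1⟩, hc3⟩, hxle⟩, hxb1⟩, hxb3⟩ :=
      ((((((((hp3 u1 hu1).and (hp3 u2 hu2)).and (hp3 u3 hu3)).and hf1).and hf3).and
        hle).and hb1).and hb3).exists
    rw [eventually_map, eventually_lowEnd] at hxb1 hxb3
    obtain ⟨d1, hd1, hd1'⟩ := hxb1 hx1
    obtain ⟨d3, hd3, hd3'⟩ := hxb3 hx3
    exact fiber_contra (L := L) (D1 := fun y => D u1 (x, y)) (D2 := fun y => D u2 (x, y))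
      (D3 := fun y => D u3 (x, y)) (X' := fun y => D u' (x, y)) Def.auto
      (fun y hy => h2 _ hy) hx2 hd1 hd1' hd3 hd3' hxle
      (fun e he h => (hc3 e he).1 ((hc1 e he).2 h))

theorem main_pw (A : Set M) : ∀ n, MainFor L A (Pw M n)
  | 0 => main_unit A
  | n + 1 => main_step (main_pw A n)

end MainPart

end OM



set_option linter.unusedSectionVars false

namespace OM

open Filter

section Transfer

/-- From iterated products to functions. -/
def toFn {M : Type u} : (n : ℕ) → Pw M n → Fin n → M
  | 0, _ => Fin.elim0
  | n + 1, x => Fin.snoc (α := fun _ => M) (toFn n x.1) x.2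

/-- From functions to iterated products. -/
def ofFn {M : Type u} : (n : ℕ) → (Fin n → M) → Pw M n
  | 0, _ => PUnit.unit
  | n + 1, v => (ofFn n (fun i => v i.castSucc), v (Fin.last n))

theorem toFn_ofFn {M : Type u} : ∀ (n : ℕ) (v : Fin n → M), toFn n (ofFn n v) = v
  | 0, v => by
    funext i
    exact i.elim0
  | n + 1, v => by
    show Fin.snoc (α := fun _ => M) (toFn n (ofFn n (fun i => v i.castSucc))) (v (Fin.last n)) = v
    rw [toFn_ofFn n]
    exact Fin.snoc_init_self v

variable {L : FirstOrder.Language} {M : Type u} [L.Structure M]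
variable {X Y Z : Type u} [Tup M X] [Tup M Y] [Tup M Z]

theorem CMap.comp {g : Y → Z} {f : X → Y} (hg : CMap M g) (hf : CMap M f) :
    CMap M (fun x => g (f x)) := by
  obtain ⟨σ, hσ⟩ := hg
  obtain ⟨τ, hτ⟩ := hf
  exact ⟨fun i => τ (σ i), fun x i => by rw [hσ, hτ]⟩

theorem cmap_ofFn : ∀ n, CMap M (ofFn (M := M) n)
  | 0 => ⟨fun i => i.elim, fun _ i => i.elim⟩
  | n + 1 => by
    have h1 : CMap M (fun v : Fin (n + 1) → M => fun i : Fin n => v i.castSucc) :=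
      ⟨fun i => Fin.castSucc i, fun _ _ => rfl⟩
    have h2 : CMap M (fun v : Fin (n + 1) → M => v (Fin.last n)) :=
      ⟨fun _ => Fin.last n, fun _ _ => rfl⟩
    exact CMap.pair ((cmap_ofFn n).comp h1) h2

theorem cmap_toFn : ∀ n, CMap M (toFn (M := M) n)
  | 0 => ⟨fun i => Fin.elim0 i, fun _ i => Fin.elim0 i⟩
  | n + 1 => by
    obtain ⟨σ, hσ⟩ := cmap_toFn n
    refine ⟨fun i => Fin.lastCases (motive := fun _ => Tup.ι M (Pw M n) ⊕ Fin 1) (Sum.inr 0)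
      (fun j => Sum.inl (σ j)) i, fun x i => ?_⟩
    refine Fin.lastCases ?_ (fun j => ?_) i
    · beta_reduce
      rw [Fin.lastCases_last]
      show Fin.snoc (α := fun _ => M) (toFn n x.1) x.2 (Fin.last n) = _
      rw [Fin.snoc_last]
      rfl
    · beta_reduce
      rw [Fin.lastCases_castSucc]
      show Fin.snoc (α := fun _ => M) (toFn n x.1) x.2 (Fin.castSucc j) = _
      rw [Fin.snoc_castSucc]
      exact hσ x.1 j

theorem cmap_sum {m n : ℕ} {f : X → Fin m → M} {g : X → Fin n → M} (hf : CMap M f)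
    (hg : CMap M g) : CMap M (fun x => Sum.elim (f x) (g x)) := by
  obtain ⟨σ, hσ⟩ := hf
  obtain ⟨τ, hτ⟩ := hg
  refine ⟨fun i => Sum.elim σ τ i, fun x i => ?_⟩
  rcases i with i | i
  · exact hσ x i
  · exact hτ x i

variable [LinearOrder M]

theorem final (hM : IsOMinimal L M) (A : Set M) (n : ℕ) (S : Set (Set (Fin n → M)))
    (hS : IsDefFamily L A n S) (hdir : DirectedFam S) (hSne : S.Nonempty) :
    ∃ p, IsTypeOn L n p ∧ IsDefTypeOver L A n p ∧ S ⊆ p := by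
  have : OMin L M := ⟨hM⟩
  obtain ⟨_, _, _, _, -, -⟩ := hM
  obtain ⟨m, Ω, D, hΩ, hD, rfl⟩ := hS
  obtain ⟨hem, hdir⟩ := hdir
  have hΩ' : Def L A (fun u : Fin m → M => u ∈ Ω) := hΩ
  have hD' : Def L A (fun u : Fin m ⊕ Fin n → M => u ∈ D) := hD
  obtain ⟨p, hp1, hp2, hp3⟩ := main_pw (L := L) A n m (fun u => toFn m u ∈ Ω)
    (fun u x => Sum.elim (toFn m u) (toFn n x) ∈ D) (hΩ'.ccomp (cmap_toFn m))
    (hD'.ccomp (f := fun z : Pw M m × Pw M n => Sum.elim (toFn m z.1) (toFn n z.2))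
      (cmap_sum ((cmap_toFn m).comp CMap.id.fst) ((cmap_toFn n).comp CMap.id.snd)))
    (by
      obtain ⟨_, u, hu, -⟩ := hSne
      exact ⟨ofFn m u, by rwa [toFn_ofFn]⟩)
    (by
      intro u hu
      by_contra hcon
      apply hem
      refine ⟨toFn m u, hu, ?_⟩
      ext v
      refine ⟨fun hv => hcon ⟨ofFn n v, ?_⟩, fun hv => hv.elim⟩
      rw [toFn_ofFn]
      exact hv)
    (by
      intro u u' hu hu'
      obtain ⟨_, ⟨u'', h1, rfl⟩, h2⟩ := hdir _ ⟨_, hu, rfl⟩ _ ⟨_, hu', rfl⟩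
      refine ⟨ofFn m u'', by rwa [toFn_ofFn], fun x hx => ?_⟩
      rw [toFn_ofFn] at hx
      exact h2 hx)
  have hnb := hp2.neBot
  have hsec : ∀ (B : Set M) (k : ℕ) (E : Set (Fin k ⊕ Fin n → M)), B.Definable L E → ∀ u,
      (univ : Set M).Definable L (famFiber E u) := by
    intro B k E hE u
    have hE' : Def L (univ : Set M) (fun u : Fin k ⊕ Fin n → M => u ∈ E) :=
      hE.mono (Set.subset_univ B)
    have h1 : Def L (univ : Set M) (fun z : (Fin k → M) × (Fin n → M) => Sum.elim z.1 z.2 ∈ E) :=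
      hE'.ccomp (cmap_sum CMap.id.fst CMap.id.snd)
    exact h1.comp (f := fun v => (u, v)) ((DMap.cst u).pair DMap.id)
  refine ⟨{Y | (univ : Set M).Definable L Y ∧ ∀ᶠ x in p, toFn n x ∈ Y}, ⟨?_, ?_, ?_, ?_, ?_⟩, ?_, ?_⟩
  · exact fun Y hY => hY.1
  · rintro ⟨-, h⟩
    obtain ⟨x, hx⟩ := h.exists
    exact hx
  · intro Y hY Z hZ
    exact ⟨hY.1.inter hZ.1, (hY.2.and hZ.2).mono fun x hx => hx⟩
  · intro Y hY Z hZ hYZ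
    exact ⟨hZ, hY.2.mono fun x hx => hYZ hx⟩
  · intro Y hY
    have hY' : Def L (univ : Set M) (fun v : Fin n → M => v ∈ Y) := hY
    rcases hp2.ultra (fun x => toFn n x ∈ Y) (hY'.ccomp (cmap_toFn n)) with h | h
    · exact Or.inl ⟨hY, h⟩
    · exact Or.inr ⟨hY.compl, h⟩
  · intro k E hE
    have hE' : Def L A (fun u : Fin k ⊕ Fin n → M => u ∈ E) := hE.mono (Set.empty_subset A)
    have h1 : Def L A (fun u : Fin k → M => ∀ᶠ x in p, Sum.elim u (toFn n x) ∈ E) :=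
      hp1 A (Set.Subset.refl _) (Fin k → M) (fun u x => Sum.elim u (toFn n x) ∈ E)
        (hE'.ccomp (f := fun z : (Fin k → M) × Pw M n => Sum.elim z.1 (toFn n z.2))
          (cmap_sum CMap.id.fst ((cmap_toFn n).comp CMap.id.snd)))
    have h2 : {u : Fin k → M | famFiber E u ∈ {Y | (univ : Set M).Definable L Y ∧
        ∀ᶠ x in p, toFn n x ∈ Y}} = {u | ∀ᶠ x in p, Sum.elim u (toFn n x) ∈ E} := by
      ext u
      exact ⟨fun h => h.2, fun h => ⟨hsec _ _ _ hE u, h⟩⟩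
    rw [h2]
    exact h1
  · rintro _ ⟨u, hu, rfl⟩
    refine ⟨hsec _ _ _ hD u, ?_⟩
    have := hp3 (ofFn m u) (by rwa [toFn_ofFn])
    rw [toFn_ofFn] at this
    exact this

end Transfer

end OM

/-- every `A`-definable downward directed family extends to an `A`-definable type. -/
theorem statement4 (L : FirstOrder.Language) (M : Type*) [L.Structure M] [LinearOrder M]
    (hM : IsOMinimal L M) (A : Set M) (n : ℕ) (S : Set (Set (Fin n → M)))
    (hS : IsDefFamily L A n S) (hdir : DirectedFam S) :
    ∃ p, IsTypeOn L n p ∧ IsDefTypeOver L A n p ∧ S ⊆ p := by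
  by_cases hne : S.Nonempty
  · exact OM.final hM A n S hS hdir hne
  · rw [Set.not_nonempty_iff_eq_empty] at hne
    subst hne
    have hMne : Nonempty M := hM.1
    have h1 : IsDefFamily L A n {(Set.univ : Set (Fin n → M))} := by
      refine ⟨0, Set.univ, Set.univ, Set.definable_univ, Set.definable_univ, ?_⟩
      ext Y
      constructor
      · rintro rfl
        exact ⟨Fin.elim0, trivial, rfl⟩
      · rintro ⟨_, -, rfl⟩
        rfl
    have h2 : DirectedFam {(Set.univ : Set (Fin n → M))} := by
      constructor
      · intro h
        exact Set.empty_ne_univ h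
      · rintro X rfl Y rfl
        exact ⟨Set.univ, rfl, fun x _ => ⟨trivial, trivial⟩⟩
    obtain ⟨p, hp1, hp2, -⟩ := OM.final hM A n _ h1 h2 ⟨_, rfl⟩
    exact ⟨p, hp1, hp2, Set.empty_subset p⟩
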